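/- Let d ≥ 1 and let α be a cone angle on ℝ^d. Then the affine hull of the set of interior angle vectors { α̂(P) : P ⊂ ℝ^d a d-dimensional polytope } ⊆ ℝ^d equals the hyperplane { (a_0, a_1, …, a_{d−1}) ∈ ℝ^d : a_0 − a_1 + a_2 − ⋯ + (−1)^{d−1} a_{d−1} = (−1)^{d+1} }. In particular, every full-dimensional polytope satisfies Gram's relation, and up to scaling this is the only linear relation satisfied by all interior angle vectors. -/

import Mathlib

open scoped BigOperators InnerProductSpace Pointwise

noncomputable section

/-- Euclidean space `ℝ^d`. -/
abbrev Euc (d : ℕ) : Type := EuclideanSpace ℝ (Fin d)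

namespace GramAngles

variable {d : ℕ}

/-- The conical (positive) hull of a set. -/
def posHull (S : Set (Euc d)) : Set (Euc d) :=
  {u | ∃ c : ℝ, ∃ p ∈ S, 0 ≤ c ∧ u = c • p}

/-- The dimension of a set: the rank of the linear subspace parallel to its affine hull. -/
def sdim (S : Set (Euc d)) : ℕ := Module.finrank ℝ (vectorSpan ℝ S)

/-- A polyhedral cone with apex at the origin: a finitely generated convex cone. -/
def IsPolyhedralCone (C : Set (Euc d)) : Prop :=
  ∃ (n : ℕ) (v : Fin n → Euc d),
    C = {x | ∃ c : Fin n → ℝ, (∀ i, 0 ≤ c i) ∧ x = ∑ i, c i • v i}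

/-- A cone angle on `ℝ^d`: a simple, normalized valuation on polyhedral cones. -/
structure ConeAngle (d : ℕ) where
  toFun : Set (Euc d) → ℝ
  zero' : toFun {0} = 0
  union' : ∀ C C' : Set (Euc d), IsPolyhedralCone C → IsPolyhedralCone C' →
    IsPolyhedralCone (C ∪ C') → IsPolyhedralCone (C ∩ C') →
    toFun (C ∪ C') = toFun C + toFun C' - toFun (C ∩ C')
  simple' : ∀ C : Set (Euc d), IsPolyhedralCone C → sdim C < d → toFun C = 0
  norm' : toFun Set.univ = 1

/-- A (convex) polytope: the convex hull of a nonempty finite point set. -/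
def IsPolytope (P : Set (Euc d)) : Prop :=
  ∃ s : Finset (Euc d), s.Nonempty ∧ P = convexHull ℝ (s : Set (Euc d))

/-- Faces of a polytope are its exposed subsets (including `∅` and `P` itself). -/
def IsFace (P F : Set (Euc d)) : Prop := IsExposed ℝ P F

open Classical in
/-- A chosen point in the relative interior of `F`. -/
def relPt (F : Set (Euc d)) : Euc d :=
  if h : (intrinsicInterior ℝ F).Nonempty then h.some else 0

/-- The tangent (inner) cone `T_F G = cone(-q + G) + L(G)^⊥`, `q ∈ relint F`. -/
def innerCone (F G : Set (Euc d)) : Set (Euc d) :=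
  posHull ((fun x => x - relPt F) '' G) + (((vectorSpan ℝ G)ᗮ : Submodule ℝ (Euc d)) : Set (Euc d))

/-- The normal cone `N_F G` of `G` at a face `F`. -/
def normalCone (F G : Set (Euc d)) : Set (Euc d) :=
  {c | ∀ x ∈ F, ∀ y ∈ G, ⟪c, y⟫_ℝ ≤ ⟪c, x⟫_ℝ}

/-- The outer cone `O_F G = N_F G + L(F)`. -/
def outerCone (F G : Set (Euc d)) : Set (Euc d) :=
  normalCone F G + ((vectorSpan ℝ F : Submodule ℝ (Euc d)) : Set (Euc d))

/-- Interior angle of `G` at its face `F`, measured by the cone angle `α`. -/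
def intAngle (α : ConeAngle d) (F G : Set (Euc d)) : ℝ := α.toFun (innerCone F G)

/-- Exterior angle of `G` at its face `F`, measured by the cone angle `α`. -/
def extAngle (α : ConeAngle d) (F G : Set (Euc d)) : ℝ := α.toFun (outerCone F G)

/-- `α̂_i(P)`: sum of interior angles over all `i`-dimensional (nonempty) faces of `P`. -/
def intAngleSum (α : ConeAngle d) (P : Set (Euc d)) (i : ℕ) : ℝ :=
  ∑ᶠ F ∈ {F : Set (Euc d) | IsFace P F ∧ F.Nonempty ∧ sdim F = i}, intAngle α F P

/-- `α̌_i(P)`: sum of exterior angles over all `i`-dimensional (nonempty) faces of `P`. -/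
def extAngleSum (α : ConeAngle d) (P : Set (Euc d)) (i : ℕ) : ℝ :=
  ∑ᶠ F ∈ {F : Set (Euc d) | IsFace P F ∧ F.Nonempty ∧ sdim F = i}, extAngle α F P

/-- A zonotope: a translate of a Minkowski sum of finitely many segments. -/
def IsZonotope (Z : Set (Euc d)) : Prop :=
  ∃ (t : Euc d) (n : ℕ) (z : Fin n → Euc d),
    Z = {x | ∃ l : Fin n → ℝ, (∀ i, |l i| ≤ 1) ∧ x = t + ∑ i, l i • z i}

/-- The face of `P` on which the linear functional `⟪c, ·⟫` is maximized. -/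
def maxFace (P : Set (Euc d)) (c : Euc d) : Set (Euc d) :=
  {x ∈ P | ∀ y ∈ P, ⟪c, y⟫_ℝ ≤ ⟪c, x⟫_ℝ}

/-- A belt polytope: a polytope whose normal fan is the fan induced by a central
hyperplane arrangement (two functionals maximize the same face iff they have the
same sign pattern with respect to the arrangement). -/
def IsBeltPolytope (P : Set (Euc d)) : Prop :=
  IsPolytope P ∧ ∃ (k : ℕ) (z : Fin k → Euc d), (∀ i, z i ≠ 0) ∧
    ∀ c c' : Euc d,
      ((∀ i, Real.sign ⟪z i, c⟫_ℝ = Real.sign ⟪z i, c'⟫_ℝ) ↔ maxFace P c = maxFace P c')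

/-- The set of flats of a polytope: linear subspaces parallel to nonempty faces,
ordered by inclusion (as a subtype of `Submodule ℝ (Euc d)`). -/
def Flats (P : Set (Euc d)) : Set (Submodule ℝ (Euc d)) :=
  {L | ∃ F : Set (Euc d), IsFace P F ∧ F.Nonempty ∧ L = vectorSpan ℝ F}

/-- Strictly increasing chains from `a` to `c` in a poset, encoded as lists. -/
def chainsFromTo {β : Type*} [Preorder β] (a c : β) : Set (List β) :=
  {l | l.Chain' (· < ·) ∧ l.head? = some a ∧ l.getLast? = some c}

/-- The Möbius function of a poset, via Philip Hall's chain formula. -/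
def mob {β : Type*} [Preorder β] (a c : β) : ℝ :=
  ∑ᶠ l ∈ chainsFromTo a c, (-1 : ℝ) ^ (l.length + 1)

/-- Whitney numbers of the first kind of a ranked poset with minimum `bot`. -/
def whitney1 {β : Type*} [Preorder β] (rk : β → ℕ) (bot : β) (i : ℕ) : ℝ :=
  ∑ᶠ a ∈ {a : β | rk a = i}, mob bot a

/-- Flag-Whitney numbers of the second kind: the number of chains with rank set `S`. -/
def flagW2 {β : Type*} [Preorder β] (rk : β → ℕ) (S : Finset ℕ) : ℕ :=
  Nat.card {l : List β // l.Chain' (· < ·) ∧ l.map rk = S.sort (· ≤ ·)}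

/-- Flag-Whitney numbers of the first kind:
`w_S = Σ μ(0̂,c₁) μ(c₁,c₂) ⋯ μ(c_{k-1},c_k)` over chains with rank set `S`. -/
def flagW1 {β : Type*} [Preorder β] (rk : β → ℕ) (bot : β) (S : Finset ℕ) : ℝ :=
  ∑ᶠ l ∈ {l : List β | l.Chain' (· < ·) ∧ l.map rk = S.sort (· ≤ ·)},
    (List.zipWith mob (bot :: l) l).prod

/-- Chains of nonempty faces of `P` whose dimensions are exactly the set `S`. -/
def faceChains (P : Set (Euc d)) (S : Finset ℕ) : Set (List (Set (Euc d))) :=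
  {l | (∀ F ∈ l, IsFace P F ∧ F.Nonempty) ∧ l.Chain' (· ⊂ ·) ∧ l.map sdim = S.sort (· ≤ ·)}

/-- The interior flag-angle `α̂_S(P) = Σ α̂(F₁,F₂) α̂(F₂,F₃) ⋯ α̂(F_k,P)`. -/
def intFlag (α : ConeAngle d) (P : Set (Euc d)) (S : Finset ℕ) : ℝ :=
  ∑ᶠ l ∈ faceChains P S, (List.zipWith (intAngle α) l (l.drop 1 ++ [P])).prod

/-- The exterior flag-angle `α̌_S(P) = Σ α̌(F₁,F₂) α̌(F₂,F₃) ⋯ α̌(F_k,P)`. -/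
def extFlag (α : ConeAngle d) (P : Set (Euc d)) (S : Finset ℕ) : ℝ :=
  ∑ᶠ l ∈ faceChains P S, (List.zipWith (extAngle α) l (l.drop 1 ++ [P])).prod

/-- Membership in the incidence algebra: vanishing off the order relation. -/
def memIA {β : Type*} [Preorder β] (h : β → β → ℝ) : Prop :=
  ∀ a c, ¬ a ≤ c → h a c = 0

/-- Convolution product of the incidence algebra. -/
def conv {β : Type*} [Preorder β] (g h : β → β → ℝ) (a c : β) : ℝ :=
  ∑ᶠ (b : β) (_ : a ≤ b ∧ b ≤ c), g a b * h b c

/-- The product `∗_k`, summing over middle elements of rank `k`. -/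
def convk {β : Type*} (rk : β → ℕ) (k : ℕ) (g h : β → β → ℝ) (a c : β) : ℝ :=
  ∑ᶠ (b : β) (_ : rk b = k), g a b * h b c

/-- The pushforward `φ_* h (q,q') = |φ⁻¹(q')|⁻¹ Σ_{p ∈ φ⁻¹(q), p' ∈ φ⁻¹(q')} h(p,p')`. -/
def pushf {β γ : Type*} (φ : β → γ) (h : β → β → ℝ) (q q' : γ) : ℝ :=
  (Nat.card {p : β // φ p = q'} : ℝ)⁻¹ *
    ∑ᶠ (p : β) (_ : φ p = q) (p' : β) (_ : φ p' = q'), h p p'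

/-- The subspace `I_φ(𝒫)`: elements whose fiberwise column sums are independent of
the representative of the target fiber. -/
def memIphi {β γ : Type*} [Preorder β] (φ : β → γ) (h : β → β → ℝ) : Prop :=
  memIA h ∧ ∀ (q : γ) (p₁ p₂ : β), φ p₁ = φ p₂ →
    (∑ᶠ (p : β) (_ : φ p = q), h p p₁) = (∑ᶠ (p : β) (_ : φ p = q), h p p₂)

open Classical in
/-- The pullback `φ^* g (p,p') = g(φ p, φ p')` for `p ≤ p'`, else `0`. -/
def pullb {β γ : Type*} [Preorder β] (φ : β → γ) (g : γ → γ → ℝ) (p p' : β) : ℝ :=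
  if p ≤ p' then g (φ p) (φ p') else 0

open Classical in
/-- The identity `δ` of the incidence algebra. -/
def deltaIA {β : Type*} (a c : β) : ℝ := if a = c then 1 else 0

end GramAngles

namespace GramAngles

section aux

variable {d : ℕ}

/-- A set is a finitely generated cone. -/
def FGc {M : Type*} [AddCommGroup M] [Module ℝ M] (C : Set M) : Prop :=
  ∃ (n : ℕ) (v : Fin n → M), C = {x | ∃ c : Fin n → ℝ, (∀ i, 0 ≤ c i) ∧ x = ∑ i, c i • v i}

section fg
variable {M : Type*} [AddCommGroup M] [Module ℝ M]

theorem FGc_of_fintype {ι : Type*} [Fintype ι] (v : ι → M) :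
    FGc {x : M | ∃ c : ι → ℝ, (∀ i, 0 ≤ c i) ∧ x = ∑ i, c i • v i} := by
  refine ⟨Fintype.card ι, v ∘ (Fintype.equivFin ι).symm, ?_⟩
  ext x
  constructor
  · rintro ⟨c, hc, rfl⟩
    refine ⟨c ∘ (Fintype.equivFin ι).symm, fun i => hc _, ?_⟩
    exact ((Fintype.equivFin ι).symm.sum_comp (fun i => c i • v i)).symm
  · rintro ⟨c, hc, rfl⟩
    refine ⟨c ∘ (Fintype.equivFin ι), fun i => hc _, ?_⟩
    rw [← (Fintype.equivFin ι).symm.sum_comp]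
    simp

theorem FGc_univ [Module.Finite ℝ M] : FGc (Set.univ : Set M) := by
  let b := Module.finBasis ℝ M
  have := FGc_of_fintype (ι := Fin (Module.finrank ℝ M) ⊕ Fin (Module.finrank ℝ M))
    (Sum.elim b (fun i => - b i))
  convert this
  ext x
  simp only [Set.mem_univ, true_iff, Set.mem_setOf_eq]
  refine ⟨Sum.elim (fun i => max (b.repr x i) 0) (fun i => max (-(b.repr x i)) 0), ?_, ?_⟩
  · rintro (i | i) <;> simp
  · simp only [Fintype.sum_sum_type, Sum.elim_inl, Sum.elim_inr, smul_neg]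
    rw [← Finset.sum_add_distrib]
    conv_lhs => rw [← b.sum_repr x]
    refine Finset.sum_congr rfl fun i _ => ?_
    rw [← sub_eq_add_neg, ← sub_smul]
    congr 1
    rcases le_total 0 (b.repr x i) with h | h
    · rw [max_eq_left h, max_eq_right (by linarith)]; ring
    · rw [max_eq_right h, max_eq_left (by linarith)]; ring

theorem cone_sum_mem {κ : Type*} [Fintype κ] (u : κ → M) {ι : Type*} (s : Finset ι) (g : ι → M)
    (hg : ∀ i ∈ s, g i ∈ {x : M | ∃ c : κ → ℝ, (∀ i, 0 ≤ c i) ∧ x = ∑ i, c i • u i}) :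
    ∑ i ∈ s, g i ∈ {x : M | ∃ c : κ → ℝ, (∀ i, 0 ≤ c i) ∧ x = ∑ i, c i • u i} := by
  classical
  induction s using Finset.induction_on with
  | empty => exact ⟨0, by simp, by simp⟩
  | insert a s ha ih =>
    rw [Finset.sum_insert ha]
    obtain ⟨c, hc, h1⟩ := hg a (by simp)
    obtain ⟨c', hc', h2⟩ := ih (fun i hi => hg i (by simp [hi]))
    refine ⟨c + c', fun i => add_nonneg (hc i) (hc' i), ?_⟩
    rw [h1, h2, ← Finset.sum_add_distrib]
    simp [add_smul]

theorem sum_sign_split {n : ℕ} {N : Type*} [AddCommMonoid N] (t : Fin n → ℝ) (g : Fin n → N) :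
    ∑ i, g i = ∑ i ∈ Finset.univ.filter (fun i => 0 < t i), g i +
      ∑ i ∈ Finset.univ.filter (fun i => t i < 0), g i +
      ∑ i ∈ Finset.univ.filter (fun i => t i = 0), g i := by
  simp only [Finset.sum_filter]
  rw [← Finset.sum_add_distrib, ← Finset.sum_add_distrib]
  refine Finset.sum_congr rfl fun i _ => ?_
  rcases lt_trichotomy (t i) 0 with h | h | h
  · simp [h, h.ne, h.not_gt]
  · simp [h]
  · simp [h, h.ne', h.not_gt]

theorem FGc_inter {C : Set M} (hC : FGc C) (f : M →ₗ[ℝ] ℝ) : FGc (C ∩ {x | f x ≤ 0}) := by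
  classical
  obtain ⟨n, v, rfl⟩ := hC
  let u : Fin n ⊕ (Fin n × Fin n) → M := Sum.elim (fun i => if f (v i) ≤ 0 then v i else 0)
    (fun ij => if 0 < f (v ij.1) ∧ f (v ij.2) < 0 then
      f (v ij.1) • v ij.2 - f (v ij.2) • v ij.1 else 0)
  have key := FGc_of_fintype u
  convert key
  have hsingle : ∀ (k) (r : ℝ), 0 ≤ r → r • u k ∈
      {x : M | ∃ c : (Fin n ⊕ (Fin n × Fin n)) → ℝ, (∀ i, 0 ≤ c i) ∧ x = ∑ i, c i • u i} := by
    intro k r hr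
    refine ⟨Pi.single k r, fun i => ?_, ?_⟩
    · by_cases h : i = k
      · subst h; simpa
      · simp [h]
    · rw [Finset.sum_eq_single k] <;> simp +contextual
  ext x
  constructor
  · rintro ⟨⟨c, hc, rfl⟩, hx⟩
    have hx' : ∑ i, c i * f (v i) ≤ 0 := by simpa using hx
    set P := Finset.univ.filter (fun i => 0 < f (v i)) with hP
    set Q := Finset.univ.filter (fun i => f (v i) < 0) with hQ
    set Z := Finset.univ.filter (fun i => f (v i) = 0) with hZ
    have split := @sum_sign_split n M _ (fun i => f (v i)) 
    have splitR := @sum_sign_split n ℝ _ (fun i => f (v i))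
    set p := ∑ i ∈ P, c i * f (v i) with hp
    set q := ∑ i ∈ Q, c i * (- f (v i)) with hq
    have hpq : p ≤ q := by
      have h1 := splitR (fun i => c i * f (v i))
      simp only [← hP, ← hQ, ← hZ] at h1
      have h2 : ∑ i ∈ Z, c i * f (v i) = 0 := Finset.sum_eq_zero fun i hi => by
        rw [(Finset.mem_filter.1 hi).2, mul_zero]
      have h3 : q = - ∑ i ∈ Q, c i * f (v i) := by simp [hq]
      linarith
    have hp0 : 0 ≤ p := Finset.sum_nonneg fun i hi =>
      mul_nonneg (hc i) (Finset.mem_filter.1 hi).2.le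
    have hZQ : ∀ (i) (r : ℝ), f (v i) ≤ 0 → 0 ≤ r → r • v i ∈
      {x : M | ∃ c : (Fin n ⊕ (Fin n × Fin n)) → ℝ, (∀ i, 0 ≤ c i) ∧ x = ∑ i, c i • u i} := by
      intro i r h1 h2
      have := hsingle (Sum.inl i) r h2
      simpa only [u, Sum.elim_inl, if_pos h1] using this
    rcases (hp0.trans hpq).eq_or_lt with hq0 | hq0
    · have hp1 : p = 0 := le_antisymm (hpq.trans hq0.ge) hp0
      have hcP : ∀ i ∈ P, c i = 0 := by
        intro i hi
        have := (Finset.sum_eq_zero_iff_of_nonneg (fun i hi =>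
          mul_nonneg (hc i) (Finset.mem_filter.1 hi).2.le)).1 hp1 i hi
        rcases mul_eq_zero.1 this with h | h
        · exact h
        · exact absurd h (Finset.mem_filter.1 hi).2.ne'
      apply cone_sum_mem
      intro i _
      rcases le_or_gt (f (v i)) 0 with h | h
      · exact hZQ i _ h (hc i)
      · rw [hcP i (by simp [hP, h]), zero_smul]
        simpa using hsingle (Sum.inl i) 0 le_rfl
    · have e : ∑ i, c i • v i = ∑ k ∈ Finset.univ (α := Fin 3), (![∑ i ∈ Z, c i • v i,
          ∑ j ∈ Q, ((1 - p / q) * c j) • v j,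
          ∑ ij ∈ P ×ˢ Q, (q⁻¹ * c ij.1 * c ij.2) •
            (f (v ij.1) • v ij.2 - f (v ij.2) • v ij.1)] : Fin 3 → M) k := by
        rw [Fin.sum_univ_three]
        simp only [Matrix.cons_val_zero, Matrix.cons_val_one, Matrix.cons_val]
        have h1 : ∑ ij ∈ P ×ˢ Q, (q⁻¹ * c ij.1 * c ij.2) •
            (f (v ij.1) • v ij.2 - f (v ij.2) • v ij.1) =
            (p / q) • ∑ j ∈ Q, c j • v j + ∑ i ∈ P, c i • v i := by
          have h2 : ∑ i ∈ P, c i • v i = (q⁻¹ * q) • ∑ i ∈ P, c i • v i := by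
            rw [inv_mul_cancel₀ hq0.ne', one_smul]
          rw [h2, Finset.sum_product]
          simp only [smul_sub, Finset.sum_sub_distrib]
          rw [sub_eq_add_neg]
          congr 1
          · rw [div_eq_mul_inv, hp, Finset.sum_mul, Finset.sum_smul]
            refine Finset.sum_congr rfl fun i _ => ?_
            rw [Finset.smul_sum]
            refine Finset.sum_congr rfl fun j _ => ?_
            simp only [smul_smul]; congr 1; ring
          · rw [Finset.smul_sum, ← Finset.sum_neg_distrib]
            refine Finset.sum_congr rfl fun i _ => ?_
            rw [hq, Finset.mul_sum, Finset.sum_smul, ← Finset.sum_neg_distrib]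
            refine Finset.sum_congr rfl fun j _ => ?_
            simp only [smul_smul, ← neg_smul]; congr 1; ring
        rw [h1, split (fun i => c i • v i)]
        simp only [← hP, ← hQ, ← hZ]
        have h3 : ∑ j ∈ Q, ((1 - p / q) * c j) • v j = ∑ j ∈ Q, c j • v j -
            (p / q) • ∑ j ∈ Q, c j • v j := by
          rw [Finset.smul_sum, ← Finset.sum_sub_distrib]
          refine Finset.sum_congr rfl fun j _ => ?_
          rw [sub_mul, one_mul, sub_smul, smul_smul]
        rw [h3]; abel
      rw [e]
      apply cone_sum_mem
      intro k _
      fin_cases k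
      · change ∑ i ∈ Z, c i • v i ∈ _
        apply cone_sum_mem
        intro i hi
        exact hZQ i _ (Finset.mem_filter.1 hi).2.le (hc i)
      · change ∑ j ∈ Q, ((1 - p / q) * c j) • v j ∈ _
        apply cone_sum_mem
        intro i hi
        refine hZQ i _ (Finset.mem_filter.1 hi).2.le (mul_nonneg ?_ (hc i))
        rw [sub_nonneg, div_le_one hq0]; exact hpq
      · change ∑ ij ∈ P ×ˢ Q, (q⁻¹ * c ij.1 * c ij.2) •
            (f (v ij.1) • v ij.2 - f (v ij.2) • v ij.1) ∈ _
        apply cone_sum_mem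
        rintro ⟨i, j⟩ hij
        obtain ⟨hi, hj⟩ := Finset.mem_product.1 hij
        have := hsingle (Sum.inr (i, j)) (q⁻¹ * c i * c j)
          (mul_nonneg (mul_nonneg (inv_nonneg.2 hq0.le) (hc i)) (hc j))
        simpa only [u, Sum.elim_inr, if_pos (And.intro (Finset.mem_filter.1 hi).2
          (Finset.mem_filter.1 hj).2)] using this
  · intro hx
    obtain ⟨c, hc, rfl⟩ := hx
    constructor
    · apply cone_sum_mem
      rintro (i | ⟨i, j⟩) _
      · simp only [u, Sum.elim_inl]
        split_ifs with h
        · refine ⟨Pi.single i (c (Sum.inl i)), fun k => ?_, ?_⟩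
          · by_cases h : k = i
            · subst h; simpa using hc _
            · simp [h]
          · rw [Finset.sum_eq_single i] <;> simp +contextual
        · exact ⟨0, by simp, by simp⟩
      · simp only [u, Sum.elim_inr]
        split_ifs with h
        · refine ⟨Pi.single j (c (Sum.inr (i, j)) * f (v i)) +
            Pi.single i (c (Sum.inr (i, j)) * (- f (v j))), fun k => ?_, ?_⟩
          · refine add_nonneg ?_ ?_
            · by_cases h' : k = j
              · subst h'; simpa using mul_nonneg (hc _) h.1.le
              · simp [h']
            · by_cases h' : k = i
              · subst h'; rw [Pi.single_eq_same]
                exact mul_nonneg (hc _) (by linarith [h.2])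
              · simp [h']
          · simp only [Pi.add_apply, add_smul, Finset.sum_add_distrib]
            rw [Finset.sum_eq_single j, Finset.sum_eq_single i]
            · simp only [Pi.single_eq_same]
              module
            all_goals simp +contextual
        · exact ⟨0, by simp, by simp⟩
    · simp only [Set.mem_setOf_eq, map_sum, map_smul, smul_eq_mul]
      refine Finset.sum_nonpos fun k _ => mul_nonpos_of_nonneg_of_nonpos (hc k) ?_
      rcases k with i | ⟨i, j⟩
      · simp only [u, Sum.elim_inl]; split_ifs with h <;> simp [h]
      · simp only [u, Sum.elim_inr]; split_ifs with h
        · simp; linarith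
        · simp

theorem FGc_dual [Module.Finite ℝ M] {V : Set (M →ₗ[ℝ] ℝ)} (hV : V.Finite) :
    FGc {x : M | ∀ f ∈ V, f x ≤ 0} := by
  induction V, hV using Set.Finite.induction_on with
  | empty => simpa using FGc_univ (M := M)
  | @insert f V _ _ ih =>
    convert FGc_inter ih f using 1
    ext x; simp [and_comm]

end fg

/-- The polar cone of a set of vectors. -/
def dc (V : Set (Euc d)) : Set (Euc d) := {x | ∀ v ∈ V, ⟪v, x⟫_ℝ ≤ 0}

theorem mem_dc {V : Set (Euc d)} {x : Euc d} : x ∈ dc V ↔ ∀ v ∈ V, ⟪v, x⟫_ℝ ≤ 0 := Iff.rfl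

theorem dc_poly {V : Set (Euc d)} (hV : V.Finite) : IsPolyhedralCone (dc V) := by
  have := FGc_dual (M := Euc d) (hV.image (fun v => innerₛₗ ℝ v))
  have e : {x : Euc d | ∀ f ∈ (fun v => innerₛₗ ℝ v) '' V, f x ≤ 0} = dc V := by
    ext x
    simp [mem_dc]
  rw [e] at this
  exact this

theorem dc_empty : dc (∅ : Set (Euc d)) = Set.univ := by
  ext; simp [mem_dc]

theorem alpha_flat (α : ConeAngle d) {V : Set (Euc d)} (hV : V.Finite) {v : Euc d} (hv : v ≠ 0)
    (h : ∀ x ∈ dc V, ⟪v, x⟫_ℝ = 0) : α.toFun (dc V) = 0 := by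
  apply α.simple' _ (dc_poly hV)
  have h1 : vectorSpan ℝ (dc V) ≤ (ℝ ∙ v)ᗮ := by
    rw [vectorSpan_def, Submodule.span_le]
    rintro _ ⟨x, hx, y, hy, rfl⟩
    rw [SetLike.mem_coe, Submodule.mem_orthogonal_singleton_iff_inner_right]
    simp [inner_sub_right, h x hx, h y hy]
  have h2 := Submodule.finrank_mono h1
  have h3 := Submodule.finrank_add_finrank_orthogonal (K := (ℝ ∙ v))
  rw [finrank_span_singleton hv] at h3
  simp only [finrank_euclideanSpace, Fintype.card_fin] at h3
  unfold sdim
  omega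

theorem alpha_cut (α : ConeAngle d) {V : Set (Euc d)} (hV : V.Finite) {v : Euc d} (hv : v ≠ 0) :
    α.toFun (dc V) = α.toFun (dc (insert v V)) + α.toFun (dc (insert (-v) V)) := by
  have e1 : dc (insert v V) ∪ dc (insert (-v) V) = dc V := by
    ext x
    simp only [Set.mem_union, mem_dc, Set.mem_insert_iff, forall_eq_or_imp, inner_neg_left]
    constructor
    · rintro (h | h) <;> exact h.2
    · intro h
      rcases le_total ⟪v, x⟫_ℝ 0 with h' | h'
      · exact Or.inl ⟨h', h⟩
      · exact Or.inr ⟨by linarith, h⟩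
  have e2 : dc (insert v V) ∩ dc (insert (-v) V) = dc (insert v (insert (-v) V)) := by
    ext x
    simp only [Set.mem_inter_iff, mem_dc, Set.mem_insert_iff, forall_eq_or_imp]
    tauto
  have hu := α.union' (dc (insert v V)) (dc (insert (-v) V)) (dc_poly (hV.insert _))
    (dc_poly (hV.insert _)) (by rw [e1]; exact dc_poly hV)
    (by rw [e2]; exact dc_poly ((hV.insert _).insert _))
  rw [e1, e2] at hu
  rw [hu, alpha_flat α ((hV.insert (-v)).insert v) hv, sub_zero]
  intro x hx
  have h1 := hx v (by simp)
  have h2 := hx (-v) (by simp)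
  rw [inner_neg_left] at h2
  linarith

section fam
variable {ι : Type*} [DecidableEq ι]

theorem alpha_inclexcl (α : ConeAngle d) (a : ι → Euc d) (I : Finset ι) :
    (∀ i ∈ I, a i ≠ 0) → ∀ {V : Set (Euc d)}, V.Finite →
    ∑ A ∈ I.powerset, (-1 : ℝ) ^ A.card * α.toFun (dc (V ∪ a '' (A : Set ι))) =
      α.toFun (dc (V ∪ (fun i => - a i) '' (I : Set ι))) := by
  induction I using Finset.induction_on with
  | empty => intro _ V _; simp
  | insert i I hi ih =>
    intro ha V hV
    rw [Finset.sum_powerset_insert hi, ← Finset.sum_add_distrib]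
    have h1 := ih (fun j hj => ha j (by simp [hj])) (V := insert (- a i) V) (hV.insert _)
    have e : insert (-a i) V ∪ (fun i => -a i) '' (I : Set ι) =
        V ∪ (fun i => -a i) '' ((insert i I : Finset ι) : Set ι) := by
      ext; simp; tauto
    rw [e] at h1
    rw [← h1]
    refine Finset.sum_congr rfl fun A hA => ?_
    have hiA : i ∉ A := fun h => hi (Finset.mem_powerset.1 hA h)
    rw [alpha_cut α (hV.union (A.finite_toSet.image a)) (ha i (by simp)),
      Finset.card_insert_of_notMem hiA, pow_succ]
    have e1 : V ∪ a '' ((insert i A : Finset ι) : Set ι) = insert (a i) (V ∪ a '' (A : Set ι)) := by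
      ext; simp; tauto
    rw [e1, Set.insert_union]
    ring

theorem alpha_decomp (α : ConeAngle d) (a : ι → Euc d) (I : Finset ι) :
    (∀ i ∈ I, a i ≠ 0) → ∀ {V : Set (Euc d)}, V.Finite →
    α.toFun (dc V) = ∑ N ∈ I.powerset,
      α.toFun (dc (V ∪ a '' (N : Set ι) ∪ (fun i => - a i) '' ((I \ N : Finset ι) : Set ι))) := by
  induction I using Finset.induction_on with
  | empty => intro _ V _; simp
  | insert i I hi ih =>
    intro ha V hV
    rw [Finset.sum_powerset_insert hi, alpha_cut α hV (ha i (by simp)), add_comm,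
      ih (fun j hj => ha j (by simp [hj])) (V := insert (- a i) V) (hV.insert _),
      ih (fun j hj => ha j (by simp [hj])) (V := insert (a i) V) (hV.insert _)]
    congr 1
    · refine Finset.sum_congr rfl fun A hA => ?_
      have hiA : i ∉ A := fun h => hi (Finset.mem_powerset.1 hA h)
      congr 2
      rw [Finset.insert_sdiff_of_notMem _ hiA]
      simp only [Finset.coe_insert, Set.image_insert_eq, Set.insert_union, Set.union_insert]
    · refine Finset.sum_congr rfl fun A hA => ?_
      congr 2
      have e : insert i I \ insert i A = I \ A := by
        ext j; simp only [Finset.mem_sdiff, Finset.mem_insert]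
        by_cases hj : j = i
        · subst hj; simp [hi]
        · simp [hj]
      rw [e]
      simp only [Finset.coe_insert, Set.image_insert_eq, Set.insert_union, Set.union_insert]

/-- The chamber function. -/
def wch (α : ConeAngle d) (a : ι → Euc d) (V : Set (Euc d)) (I N : Finset ι) : ℝ :=
  α.toFun (dc (V ∪ a '' (N : Set ι) ∪ (fun i => - a i) '' ((I \ N : Finset ι) : Set ι)))

theorem alpha_up (α : ConeAngle d) (a : ι → Euc d) {I : Finset ι}
    (ha : ∀ i ∈ I, a i ≠ 0) {V : Set (Euc d)} (hV : V.Finite) {A : Finset ι} (hA : A ⊆ I) :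
    α.toFun (dc (V ∪ a '' (A : Set ι))) =
      ∑ N ∈ I.powerset, if A ⊆ N then wch α a V I N else 0 := by
  rw [alpha_decomp α a I ha (hV.union (A.finite_toSet.image a))]
  refine Finset.sum_congr rfl fun N hN => ?_
  split_ifs with h
  · unfold wch
    rw [Set.union_assoc V, ← Set.image_union,
      Set.union_eq_right.2 (show (A : Set ι) ⊆ (N : Set ι) by exact_mod_cast h)]
  · obtain ⟨i, hiA, hiN⟩ := Finset.not_subset.1 h
    refine alpha_flat α ?_ (ha i (hA hiA)) ?_
    · exact ((hV.union (A.finite_toSet.image a)).union (N.finite_toSet.image a)).union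
        ((Finset.finite_toSet _).image _)
    · intro x hx
      have h1 := hx (a i) (Or.inl (Or.inl (Or.inr ⟨i, by simpa using hiA, rfl⟩)))
      have h2 := hx (- a i) (Or.inr ⟨i, by simp [hA hiA, hiN], rfl⟩)
      rw [inner_neg_left] at h2
      linarith

end fam

section sys
variable {ι : Type*} [DecidableEq ι]

/-- Points whose set of active constraints is exactly `A`. -/
def cell (I : Finset ι) (a : ι → Euc d) (b : ι → ℝ) (A : Finset ι) : Set (Euc d) :=
  {x | (∀ j ∈ A, ⟪a j, x⟫_ℝ = b j) ∧ ∀ j ∈ I, j ∉ A → ⟪a j, x⟫_ℝ < b j}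

theorem mem_cell {I : Finset ι} {a : ι → Euc d} {b : ι → ℝ} {A : Finset ι} {x : Euc d} :
    x ∈ cell I a b A ↔
      (∀ j ∈ A, ⟪a j, x⟫_ℝ = b j) ∧ ∀ j ∈ I, j ∉ A → ⟪a j, x⟫_ℝ < b j := Iff.rfl

open Classical in
/-- The active sets. -/
def AA (I : Finset ι) (a : ι → Euc d) (b : ι → ℝ) : Finset (Finset ι) :=
  I.powerset.filter (fun A => (cell I a b A).Nonempty)

/-- Rank of a set of constraints. -/
def rk (a : ι → Euc d) (A : Finset ι) : ℕ :=
  Module.finrank ℝ (Submodule.span ℝ (a '' (A : Set ι)))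

/-- The signed angle sum of a system. -/
def Psi (α : ConeAngle d) (I : Finset ι) (a : ι → Euc d) (b : ι → ℝ) : ℝ :=
  ∑ A ∈ AA I a b, (-1 : ℝ) ^ rk a A * α.toFun (dc (a '' (A : Set ι)))

theorem perturb (S : Finset ι) (a : ι → Euc d) (b : ι → ℝ) (x u : Euc d)
    (h : ∀ j ∈ S, ⟪a j, x⟫_ℝ < b j) :
    ∃ ε > 0, ∀ δ : ℝ, |δ| ≤ ε → ∀ j ∈ S, ⟪a j, x + δ • u⟫_ℝ < b j := by
  have h1 : ∀ᶠ δ in nhds (0 : ℝ), ∀ j ∈ S, ⟪a j, x + δ • u⟫_ℝ < b j := by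
    rw [Filter.eventually_all_finset]
    intro j hj
    have hc : Continuous (fun δ : ℝ => ⟪a j, x + δ • u⟫_ℝ) := by fun_prop
    have := hc.tendsto 0
    simp only [zero_smul, add_zero] at this
    exact this.eventually_lt_const (h j hj)
  obtain ⟨ε, hε, H⟩ := Metric.eventually_nhds_iff.1 h1
  refine ⟨ε / 2, by positivity, fun δ hδ => H ?_⟩
  rw [Real.dist_eq, sub_zero]
  linarith

theorem solve_lin (I : Finset ι) (a : ι → Euc d) (γ : ι → ℝ)
    (h : ∀ c : ι → ℝ, ∑ i ∈ I, c i • a i = 0 → ∑ i ∈ I, c i * γ i = 0) :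
    ∃ x, ∀ i ∈ I, ⟪a i, x⟫_ℝ = γ i := by
  let T : Euc d →ₗ[ℝ] (I → ℝ) := LinearMap.pi (fun i => innerₛₗ ℝ (a i))
  by_contra! hx
  have hn : (fun i : I => γ i) ∉ LinearMap.range T := by
    rintro ⟨x, hx'⟩
    obtain ⟨i, hi, hne⟩ := hx x
    apply hne
    have := congrFun hx' ⟨i, hi⟩
    simpa [T] using this
  obtain ⟨f, hf, hker⟩ := Submodule.exists_le_ker_of_notMem hn
  let c : ι → ℝ := fun i => if hi : i ∈ I then f (Pi.single ⟨i, hi⟩ 1) else 0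
  have hfc : ∀ g : ι → ℝ, f (fun i : I => g i) = ∑ i ∈ I, c i * g i := by
    intro g
    have e : (fun i : I => g i) = ∑ i : I, g i • (Pi.single i (1 : ℝ) : I → ℝ) := by
      ext j
      simp [Finset.sum_apply, Pi.single_apply]
    rw [e, map_sum, ← Finset.sum_coe_sort I]
    refine Finset.sum_congr rfl fun i _ => ?_
    simp [c, mul_comm]
  apply hf
  rw [hfc]
  apply h
  rw [← inner_self_eq_zero (𝕜 := ℝ), sum_inner]
  have h2 := hker (LinearMap.mem_range_self T (∑ i ∈ I, c i • a i))
  rw [LinearMap.mem_ker] at h2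
  have h3 := hfc (fun i => ⟪a i, ∑ i ∈ I, c i • a i⟫_ℝ)
  have h4 : T (∑ i ∈ I, c i • a i) = fun i : I => ⟪a i, ∑ i ∈ I, c i • a i⟫_ℝ := rfl
  rw [← h4, h2] at h3
  rw [h3]
  refine Finset.sum_congr rfl fun i _ => ?_
  rw [real_inner_smul_left]

theorem rk_card (a : ι → Euc d) (A : Finset ι)
    (h : ∀ c : ι → ℝ, ∑ i ∈ A, c i • a i = 0 → ∀ i ∈ A, c i = 0) : rk a A = A.card := by
  have h1 : LinearIndepOn ℝ a (A : Set ι) := linearIndepOn_finset_iff.2 h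
  have h2 := finrank_span_eq_card (R := ℝ) (b := fun i : (A : Set ι) => a i) h1
  unfold rk
  rw [Set.image_eq_range, h2]
  simp

theorem Psi_eq (α : ConeAngle d) (I : Finset ι) (a : ι → Euc d) (b : ι → ℝ) :
    Psi α I a b = ∑ A ∈ I.powerset, (open Classical in if (cell I a b A).Nonempty then
      (-1 : ℝ) ^ rk a A * α.toFun (dc (a '' (A : Set ι))) else 0) := by
  unfold Psi AA
  rw [Finset.sum_filter]

theorem Psi_cut (α : ConeAngle d) (I : Finset ι) (a a' : ι → Euc d) (b b' : ι → ℝ) (i : ι)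
    (hi : i ∉ I) (ha : a i ≠ 0) (hai : a' i = - a i) (hbi : b' i = - b i)
    (ha' : ∀ j ∈ I, a' j = a j) (hb' : ∀ j ∈ I, b' j = b j) :
    Psi α (insert i I) a b + Psi α (insert i I) a' b' = Psi α I a b := by
  classical
  simp only [Psi_eq]
  rw [Finset.sum_powerset_insert hi, Finset.sum_powerset_insert hi, ← Finset.sum_add_distrib,
    ← Finset.sum_add_distrib, ← Finset.sum_add_distrib]
  refine Finset.sum_congr rfl fun A hA => ?_
  have hAI := Finset.mem_powerset.1 hA
  have hiA : i ∉ A := fun h => hi (hAI h)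
  have c1 : (cell (insert i I) a b A).Nonempty ↔ ∃ x ∈ cell I a b A, ⟪a i, x⟫_ℝ < b i := by
    refine exists_congr fun x => ?_
    simp only [mem_cell, Finset.mem_insert, forall_eq_or_imp]
    tauto
  have c2 : (cell (insert i I) a b (insert i A)).Nonempty ↔
      ∃ x ∈ cell I a b A, ⟪a i, x⟫_ℝ = b i := by
    refine exists_congr fun x => ?_
    simp only [mem_cell, Finset.mem_insert, forall_eq_or_imp]
    constructor
    · rintro ⟨⟨h1, h2⟩, h3, h4⟩
      exact ⟨⟨h2, fun j hj hjA => h4 j hj (by rintro (rfl | h) <;> tauto)⟩, h1⟩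
    · rintro ⟨⟨h2, h4⟩, h1⟩
      exact ⟨⟨h1, h2⟩, fun h => (h (Or.inl trivial)).elim, fun j hj h => h4 j hj (fun h' => h (Or.inr h'))⟩
  have e1 : ∀ x, ((∀ j ∈ A, ⟪a' j, x⟫_ℝ = b' j) ↔ (∀ j ∈ A, ⟪a j, x⟫_ℝ = b j)) := fun x =>
    forall₂_congr fun j hj => by rw [ha' j (hAI hj), hb' j (hAI hj)]
  have e2 : ∀ x, ((∀ j ∈ I, j ∉ A → ⟪a' j, x⟫_ℝ < b' j) ↔
      (∀ j ∈ I, j ∉ A → ⟪a j, x⟫_ℝ < b j)) := fun x =>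
    forall₂_congr fun j hj => by rw [ha' j hj, hb' j hj]
  have c3 : (cell (insert i I) a' b' A).Nonempty ↔ ∃ x ∈ cell I a b A, b i < ⟪a i, x⟫_ℝ := by
    refine exists_congr fun x => ?_
    simp only [mem_cell, Finset.mem_insert, forall_eq_or_imp, e1, e2, hai, hbi, inner_neg_left,
      neg_lt_neg_iff]
    tauto
  have c4 : (cell (insert i I) a' b' (insert i A)).Nonempty ↔
      ∃ x ∈ cell I a b A, ⟪a i, x⟫_ℝ = b i := by
    refine exists_congr fun x => ?_
    simp only [mem_cell, Finset.mem_insert, forall_eq_or_imp, e1, hai, hbi, inner_neg_left,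
      neg_inj]
    constructor
    · rintro ⟨⟨h1, h2⟩, h3, h4⟩
      exact ⟨⟨h2, (e2 x).1 fun j hj hjA => h4 j hj (by rintro (rfl | h) <;> tauto)⟩, h1⟩
    · rintro ⟨⟨h2, h4⟩, h1⟩
      exact ⟨⟨h1, h2⟩, fun h => (h (Or.inl trivial)).elim,
        fun j hj h => (e2 x).2 h4 j hj (fun h' => h (Or.inr h'))⟩
  have im1 : a' '' (A : Set ι) = a '' (A : Set ι) :=
    Set.image_congr fun j hj => ha' j (hAI hj)
  have im2 : a '' ((insert i A : Finset ι) : Set ι) = insert (a i) (a '' (A : Set ι)) := by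
    rw [Finset.coe_insert, Set.image_insert_eq]
  have im3 : a' '' ((insert i A : Finset ι) : Set ι) = insert (- a i) (a '' (A : Set ι)) := by
    rw [Finset.coe_insert, Set.image_insert_eq, hai, im1]
  have rk1 : rk a' A = rk a A := by unfold rk; rw [im1]
  have rk2 : rk a' (insert i A) = rk a (insert i A) := by
    unfold rk
    have hs : Submodule.span ℝ {-a i} = Submodule.span ℝ {a i} := by
      rw [← Set.neg_singleton, Submodule.span_neg]
    rw [im2, im3, Submodule.span_insert, Submodule.span_insert, hs]
  have hα := alpha_cut α ((A.finite_toSet).image a) ha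
  rw [if_congr c1 rfl rfl, if_congr c2 rfl rfl, if_congr c3 rfl rfl, if_congr c4 rfl rfl,
    im1, im2, im3, rk1, rk2]
  set X := α.toFun (dc (a '' (A : Set ι)))
  set Y := α.toFun (dc (insert (a i) (a '' (A : Set ι))))
  set Z := α.toFun (dc (insert (-a i) (a '' (A : Set ι))))
  by_cases hsp : a i ∈ Submodule.span ℝ (a '' (A : Set ι))
  · have rk3 : rk a (insert i A) = rk a A := by
      unfold rk; rw [im2, Submodule.span_insert_eq_span hsp]
    have hconst : ∀ x ∈ cell I a b A, ∀ y ∈ cell I a b A, ⟪a i, x⟫_ℝ = ⟪a i, y⟫_ℝ := by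
      intro x hx y hy
      have : ∀ v ∈ Submodule.span ℝ (a '' (A : Set ι)), ⟪v, x⟫_ℝ = ⟪v, y⟫_ℝ := by
        intro v hv
        induction hv using Submodule.span_induction with
        | mem v hv =>
          obtain ⟨j, hj, rfl⟩ := hv
          rw [hx.1 j hj, hy.1 j hj]
        | zero => simp
        | add u v _ _ hu hv => simp [inner_add_left, hu, hv]
        | smul r v _ hv => simp [real_inner_smul_left, hv]
      exact this _ hsp
    rw [rk3]
    by_cases hne : (cell I a b A).Nonempty
    · rw [if_pos hne]
      obtain ⟨x, hx⟩ := hne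
      have k1 : (∃ x ∈ cell I a b A, ⟪a i, x⟫_ℝ < b i) ↔ ⟪a i, x⟫_ℝ < b i :=
        ⟨fun ⟨y, hy, h⟩ => by rwa [hconst x hx y hy], fun h => ⟨x, hx, h⟩⟩
      have k2 : (∃ x ∈ cell I a b A, ⟪a i, x⟫_ℝ = b i) ↔ ⟪a i, x⟫_ℝ = b i :=
        ⟨fun ⟨y, hy, h⟩ => by rwa [hconst x hx y hy], fun h => ⟨x, hx, h⟩⟩
      have k3 : (∃ x ∈ cell I a b A, b i < ⟪a i, x⟫_ℝ) ↔ b i < ⟪a i, x⟫_ℝ :=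
        ⟨fun ⟨y, hy, h⟩ => by rwa [hconst x hx y hy], fun h => ⟨x, hx, h⟩⟩
      rw [if_congr k1 rfl rfl, if_congr k2 rfl rfl, if_congr k3 rfl rfl, if_congr k2 rfl rfl, hα]
      rcases lt_trichotomy ⟪a i, x⟫_ℝ (b i) with h | h | h
      · simp [h, h.ne, h.not_gt]
      · simp [h]; ring
      · simp [h, h.ne', h.not_gt]
    · rw [if_neg hne, if_neg, if_neg, if_neg, if_neg]
      · simp
      all_goals exact fun ⟨x, hx, _⟩ => hne ⟨x, hx⟩
  · have rk3 : rk a (insert i A) = rk a A + 1 := by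
      unfold rk
      rw [im2, Submodule.span_insert, sup_comm]
      exact Submodule.finrank_sup_span_singleton hsp
    have hEL : ∀ s : ℝ, (∃ x ∈ cell I a b A, ⟪a i, x⟫_ℝ = b i) →
        ∃ x ∈ cell I a b A, ∃ ε > 0, ⟪a i, x⟫_ℝ = b i + s * ε := by
      rintro s ⟨x, hx, hxi⟩
      obtain ⟨u, hu, hui⟩ : ∃ u ∈ (Submodule.span ℝ (a '' (A : Set ι)))ᗮ, ⟪u, a i⟫_ℝ ≠ 0 := by
        by_contra! hcon
        apply hsp
        rw [← Submodule.orthogonal_orthogonal (Submodule.span ℝ (a '' (A : Set ι)))]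
        rw [Submodule.mem_orthogonal]
        exact hcon
      rw [real_inner_comm] at hui
      obtain ⟨ε, hε, H⟩ := perturb (I \ A) a b x ((s / ⟪a i, u⟫_ℝ) • u)
        (fun j hj => hx.2 j (Finset.mem_sdiff.1 hj).1 (Finset.mem_sdiff.1 hj).2)
      refine ⟨x + ε • (s / ⟪a i, u⟫_ℝ) • u, ⟨fun j hj => ?_, fun j hj hjA => ?_⟩, ε, hε, ?_⟩
      · have : ⟪a j, u⟫_ℝ = 0 := hu _ (Submodule.subset_span ⟨j, hj, rfl⟩)
        simp [inner_add_right, real_inner_smul_right, this, hx.1 j hj]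
      · exact H ε (by rw [abs_of_pos hε]) j (Finset.mem_sdiff.2 ⟨hj, hjA⟩)
      · simp only [inner_add_right, real_inner_smul_right, hxi]
        field_simp
    have hLG : (∃ x ∈ cell I a b A, ⟪a i, x⟫_ℝ < b i) → (∃ x ∈ cell I a b A, b i < ⟪a i, x⟫_ℝ) →
        (∃ x ∈ cell I a b A, ⟪a i, x⟫_ℝ = b i) := by
      rintro ⟨x, hx, hxi⟩ ⟨y, hy, hyi⟩
      set p := b i - ⟪a i, x⟫_ℝ with hp
      set q := ⟪a i, y⟫_ℝ - b i with hq
      have hp0 : 0 < p := by linarith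
      have hq0 : 0 < q := by linarith
      have hpq : 0 < p + q := by linarith
      have hz : ∀ v, ⟪v, (q / (p + q)) • x + (p / (p + q)) • y⟫_ℝ =
          (q * ⟪v, x⟫_ℝ + p * ⟪v, y⟫_ℝ) / (p + q) := by
        intro v
        rw [inner_add_right, real_inner_smul_right, real_inner_smul_right]
        ring
      refine ⟨(q / (p + q)) • x + (p / (p + q)) • y, ⟨fun j hj => ?_, fun j hj hjA => ?_⟩, ?_⟩
      · rw [hz, hx.1 j hj, hy.1 j hj]; field_simp; ring
      · rw [hz, div_lt_iff₀ hpq]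
        have h1 := mul_lt_mul_of_pos_left (hx.2 j hj hjA) hq0
        have h2 := mul_lt_mul_of_pos_left (hy.2 j hj hjA) hp0
        linarith
      · rw [hz, div_eq_iff hpq.ne', hp, hq]; ring
    have hE1 : (∃ x ∈ cell I a b A, ⟪a i, x⟫_ℝ = b i) →
        (∃ x ∈ cell I a b A, ⟪a i, x⟫_ℝ < b i) := fun h => by
      obtain ⟨x, hx, ε, hε, h⟩ := hEL (-1) h
      exact ⟨x, hx, by linarith⟩
    have hE2 : (∃ x ∈ cell I a b A, ⟪a i, x⟫_ℝ = b i) →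
        (∃ x ∈ cell I a b A, b i < ⟪a i, x⟫_ℝ) := fun h => by
      obtain ⟨x, hx, ε, hε, h⟩ := hEL 1 h
      exact ⟨x, hx, by linarith⟩
    have hany : (cell I a b A).Nonempty ↔ (∃ x ∈ cell I a b A, ⟪a i, x⟫_ℝ < b i) ∨
        (∃ x ∈ cell I a b A, b i < ⟪a i, x⟫_ℝ) := by
      constructor
      · rintro ⟨x, hx⟩
        rcases lt_trichotomy ⟪a i, x⟫_ℝ (b i) with h | h | h
        · exact Or.inl ⟨x, hx, h⟩
        · exact Or.inl (hE1 ⟨x, hx, h⟩)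
        · exact Or.inr ⟨x, hx, h⟩
      · rintro (⟨x, hx, _⟩ | ⟨x, hx, _⟩) <;> exact ⟨x, hx⟩
    rw [rk3, if_congr hany rfl rfl, pow_succ, hα]
    generalize (∃ x ∈ cell I a b A, ⟪a i, x⟫_ℝ < b i) = L at *
    generalize (∃ x ∈ cell I a b A, ⟪a i, x⟫_ℝ = b i) = E at *
    generalize (∃ x ∈ cell I a b A, b i < ⟪a i, x⟫_ℝ) = G at *
    by_cases hL : L
    · by_cases hG : G
      · have hE := hLG hL hG
        simp only [hL, hG, hE, if_true, true_or]; ring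
      · have hE : ¬ E := fun h => hG (hE2 h)
        simp [hL, hG, hE]
    · have hE : ¬ E := fun h => hL (hE1 h)
      by_cases hG : G
      · simp [hL, hG, hE]
      · simp [hL, hG, hE]

end sys

section gramsys
variable {ι : Type*} [DecidableEq ι]

/-- Flip signs on `T`. -/
def fl {M : Type*} [Neg M] (T : Finset ι) (a : ι → M) : ι → M :=
  fun j => if j ∈ T then - a j else a j

/-- The property that the system satisfies the Gram identity. -/
def GramOk (α : ConeAngle d) (I : Finset ι) (a : ι → Euc d) (b : ι → ℝ) : Prop :=
  Psi α I a b = α.toFun (dc ((fun i => - a i) '' (I : Set ι)))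

theorem gram_flip (α : ConeAngle d) (J : Finset ι) (i : ι) (hi : i ∉ J) (a a' : ι → Euc d)
    (b b' : ι → ℝ) (ha : a i ≠ 0) (hai : a' i = - a i) (hbi : b' i = - b i)
    (ha' : ∀ j ∈ J, a' j = a j) (hb' : ∀ j ∈ J, b' j = b j) (ih : GramOk α J a b)
    (h : GramOk α (insert i J) a' b') : GramOk α (insert i J) a b := by
  unfold GramOk at *
  have h1 := Psi_cut α J a a' b b' i hi ha hai hbi ha' hb'
  have h2 := alpha_cut α (V := (fun i => - a i) '' (J : Set ι)) ((J.finite_toSet).image _) ha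
  have im1 : (fun i => - a i) '' ((insert i J : Finset ι) : Set ι) =
      insert (- a i) ((fun i => - a i) '' (J : Set ι)) := by
    rw [Finset.coe_insert, Set.image_insert_eq]
  have im2 : (fun i => - a' i) '' ((insert i J : Finset ι) : Set ι) =
      insert (a i) ((fun i => - a i) '' (J : Set ι)) := by
    rw [Finset.coe_insert, Set.image_insert_eq, hai, neg_neg]
    congr 1
    exact Set.image_congr fun j hj => by rw [ha' j hj]
  rw [im2] at h
  rw [im1]
  linarith

theorem gram_flips (α : ConeAngle d) (I : Finset ι)
    (ih : ∀ J : Finset ι, J.card < I.card → ∀ (a : ι → Euc d) (b : ι → ℝ),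
      (∀ i ∈ J, a i ≠ 0) → GramOk α J a b) (a : ι → Euc d) (b : ι → ℝ) (ha : ∀ i ∈ I, a i ≠ 0)
    (T : Finset ι) : T ⊆ I → GramOk α I (fl T a) (fl T b) → GramOk α I a b := by
  induction T using Finset.induction_on with
  | empty =>
    intro _ h
    have e1 : fl ∅ a = a := by funext j; simp [fl]
    have e2 : fl ∅ b = b := by funext j; simp [fl]
    rwa [e1, e2] at h
  | @insert t T ht IH =>
    intro hT h
    apply IH (fun x hx => hT (Finset.mem_insert_of_mem hx))
    have htI : t ∈ I := hT (Finset.mem_insert_self _ _)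
    have hne : ∀ i ∈ I, fl T a i ≠ 0 := by
      intro i hi
      unfold fl
      split_ifs
      · exact neg_ne_zero.2 (ha i hi)
      · exact ha i hi
    rw [← Finset.insert_erase htI]
    refine gram_flip α (I.erase t) t (Finset.notMem_erase _ _) _ (fl (insert t T) a) _
      (fl (insert t T) b) (hne t htI) (by simp [fl, ht]) (by simp [fl, ht]) ?_ ?_
      (ih _ (Finset.card_erase_lt_of_mem htI) _ _
        (fun i hi => hne i (Finset.mem_of_mem_erase hi))) ?_
    · intro j hj
      simp [fl, Finset.ne_of_mem_erase hj]
    · intro j hj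
      simp [fl, Finset.ne_of_mem_erase hj]
    · rwa [Finset.insert_erase htI]

theorem gram_indep (α : ConeAngle d) (I : Finset ι) (a : ι → Euc d) (b : ι → ℝ)
    (ha : ∀ i ∈ I, a i ≠ 0)
    (hind : ∀ c : ι → ℝ, ∑ i ∈ I, c i • a i = 0 → ∀ i ∈ I, c i = 0) : GramOk α I a b := by
  classical
  unfold GramOk
  have h := alpha_inclexcl α a I ha (V := ∅) Set.finite_empty
  simp only [Set.empty_union] at h
  rw [← h, Psi_eq]
  refine Finset.sum_congr rfl fun A hA => ?_
  have hAI := Finset.mem_powerset.1 hA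
  have hne : (cell I a b A).Nonempty := by
    obtain ⟨x, hx⟩ := solve_lin I a (fun i => if i ∈ A then b i else b i - 1) (by
      intro c hc
      exact Finset.sum_eq_zero fun i hi => by rw [hind c hc i hi, zero_mul])
    refine ⟨x, fun j hj => ?_, fun j hj hjA => ?_⟩
    · rw [hx j (hAI hj), if_pos hj]
    · rw [hx j hj, if_neg hjA]; linarith
  rw [if_pos hne, rk_card a A]
  intro c hc i hi
  have := hind (fun i => if i ∈ A then c i else 0) (by
    rw [← hc]
    simp only [ite_smul, zero_smul]
    rw [Finset.sum_ite_mem, Finset.inter_eq_right.2 hAI]) i (hAI hi)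
  simpa [hi] using this

theorem gram_dep (α : ConeAngle d) (I : Finset ι) (a : ι → Euc d) (b : ι → ℝ)
    (ha : ∀ i ∈ I, a i ≠ 0) (l : ι → ℝ) (hl : ∀ i ∈ I, 0 ≤ l i)
    (hs : ∑ i ∈ I, l i • a i = 0) (hb : ∑ i ∈ I, l i * b i ≤ 0) (i0 : ι) (hi0 : i0 ∈ I)
    (hl0 : l i0 ≠ 0) : GramOk α I a b := by
  classical
  have hsum : ∀ x : Euc d, ∑ i ∈ I, l i * ⟪a i, x⟫_ℝ = 0 := by
    intro x
    have : ⟪∑ i ∈ I, l i • a i, x⟫_ℝ = 0 := by rw [hs, inner_zero_left]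
    rw [sum_inner] at this
    simpa [real_inner_smul_left] using this
  have hl0' : 0 < l i0 := lt_of_le_of_ne (hl i0 hi0) (Ne.symm hl0)
  unfold GramOk
  have hR : α.toFun (dc ((fun i => - a i) '' (I : Set ι))) = 0 := by
    refine alpha_flat α ((I.finite_toSet).image _) (ha i0 hi0) fun x hx => ?_
    have hge : ∀ i ∈ I, 0 ≤ l i * ⟪a i, x⟫_ℝ := fun i hi => by
      have := hx (- a i) ⟨i, hi, rfl⟩
      rw [inner_neg_left] at this
      exact mul_nonneg (hl i hi) (by linarith)
    have := (Finset.sum_eq_zero_iff_of_nonneg hge).1 (hsum x) i0 hi0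
    exact (mul_eq_zero.1 this).resolve_left hl0
  rw [hR, Psi]
  refine Finset.sum_eq_zero fun A hA => ?_
  obtain ⟨hAI, y, hy⟩ := Finset.mem_filter.1 hA
  rw [Finset.mem_powerset] at hAI
  have hle : ∀ i ∈ I, 0 ≤ l i * (b i - ⟪a i, y⟫_ℝ) := by
    intro i hi
    refine mul_nonneg (hl i hi) ?_
    by_cases h : i ∈ A
    · rw [hy.1 i h]; simp
    · linarith [hy.2 i hi h]
  have hz : ∑ i ∈ I, l i * (b i - ⟪a i, y⟫_ℝ) = 0 := by
    apply le_antisymm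
    · simp only [mul_sub, Finset.sum_sub_distrib, hsum]
      simpa using hb
    · exact Finset.sum_nonneg hle
  have hsupp : ∀ i ∈ I, i ∉ A → l i = 0 := by
    intro i hi hiA
    have := (Finset.sum_eq_zero_iff_of_nonneg hle).1 hz i hi
    rcases mul_eq_zero.1 this with h | h
    · exact h
    · linarith [hy.2 i hi hiA]
  rw [alpha_flat α ((A.finite_toSet).image _) (ha i0 hi0), mul_zero]
  intro x hx
  have hge : ∀ i ∈ I, l i * ⟪a i, x⟫_ℝ ≤ 0 := fun i hi => by
    by_cases h : i ∈ A
    · exact mul_nonpos_of_nonneg_of_nonpos (hl i hi) (hx (a i) ⟨i, h, rfl⟩)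
    · rw [hsupp i hi h, zero_mul]
  have := (Finset.sum_eq_zero_iff_of_nonpos hge).1 (hsum x) i0 hi0
  exact (mul_eq_zero.1 this).resolve_left hl0

theorem gram_sys (α : ConeAngle d) : ∀ (n : ℕ) (I : Finset ι), I.card = n →
    ∀ (a : ι → Euc d) (b : ι → ℝ), (∀ i ∈ I, a i ≠ 0) → GramOk α I a b := by
  intro n
  induction n using Nat.strong_induction_on with
  | _ n IH =>
  intro I hI a b ha
  by_cases hind : ∀ c : ι → ℝ, ∑ i ∈ I, c i • a i = 0 → ∀ i ∈ I, c i = 0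
  · exact gram_indep α I a b ha hind
  · push Not at hind
    obtain ⟨c, hc, i0, hi0, hc0⟩ := hind
    obtain ⟨l, hl, hlb, hl0⟩ : ∃ l : ι → ℝ, ∑ i ∈ I, l i • a i = 0 ∧ 0 ≤ ∑ i ∈ I, l i * b i ∧
        l i0 ≠ 0 := by
      rcases le_total 0 (∑ i ∈ I, c i * b i) with h | h
      · exact ⟨c, hc, h, hc0⟩
      · exact ⟨fun i => - c i, by simp [hc], by simpa using h, by simpa using hc0⟩
    refine gram_flips α I (fun J hJ a b => IH J.card (hI ▸ hJ) J rfl a b) a b ha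
      (I.filter (fun i => 0 < l i)) (Finset.filter_subset _ _) ?_
    refine gram_dep α I _ _ ?_ (fun i => |l i|) (fun i _ => abs_nonneg _) ?_ ?_ i0 hi0
      (abs_ne_zero.2 hl0)
    · intro i hi
      unfold fl
      split_ifs
      · exact neg_ne_zero.2 (ha i hi)
      · exact ha i hi
    · rw [← neg_eq_zero, ← Finset.sum_neg_distrib, ← hl]
      refine Finset.sum_congr rfl fun i hi => ?_
      by_cases h : 0 < l i
      · simp [fl, hi, h, abs_of_pos h]
      · simp [fl, h, abs_of_nonpos (not_lt.1 h)]
    · rw [← neg_nonneg, ← Finset.sum_neg_distrib]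
      refine hlb.trans_eq (Finset.sum_congr rfl fun i hi => ?_)
      by_cases h : 0 < l i
      · simp [fl, hi, h, abs_of_pos h]
      · simp [fl, h, abs_of_nonpos (not_lt.1 h)]

end gramsys

section bridge
variable {ι : Type*} [DecidableEq ι]

/-- H-polyhedron. -/
def HP (I : Finset ι) (a : ι → Euc d) (b : ι → ℝ) : Set (Euc d) :=
  {x | ∀ i ∈ I, ⟪a i, x⟫_ℝ ≤ b i}

open Classical in
/-- Active set of a point. -/
def act (I : Finset ι) (a : ι → Euc d) (b : ι → ℝ) (x : Euc d) : Finset ι :=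
  I.filter (fun i => ⟪a i, x⟫_ℝ = b i)

/-- Face of `HP` given by tight constraints. -/
def FA (I : Finset ι) (a : ι → Euc d) (b : ι → ℝ) (A : Finset ι) : Set (Euc d) :=
  {x | x ∈ HP I a b ∧ ∀ j ∈ A, ⟪a j, x⟫_ℝ = b j}

variable {I : Finset ι} {a : ι → Euc d} {b : ι → ℝ} {A : Finset ι}

theorem HP_convex : Convex ℝ (HP I a b) := by
  have : HP I a b = ⋂ i ∈ I, {x | ⟪a i, x⟫_ℝ ≤ b i} := by
    ext x; simp [HP]
  rw [this]
  refine convex_iInter₂ fun i _ => ?_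
  exact convex_halfSpace_le (innerₛₗ ℝ (a i)).isLinear (b i)

theorem HP_closed : IsClosed (HP I a b) := by
  have : HP I a b = ⋂ i ∈ I, {x | ⟪a i, x⟫_ℝ ≤ b i} := by
    ext x; simp [HP]
  rw [this]
  exact isClosed_biInter fun i _ => isClosed_le (by fun_prop) continuous_const

theorem act_cell {x : Euc d} (hx : x ∈ HP I a b) : x ∈ cell I a b (act I a b x) := by
  classical
  refine ⟨fun j hj => (Finset.mem_filter.1 hj).2, fun j hj hjA => ?_⟩
  refine lt_of_le_of_ne (hx j hj) fun h => hjA (Finset.mem_filter.2 ⟨hj, h⟩)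

theorem cell_act (hA : A ⊆ I) {x : Euc d} (hx : x ∈ cell I a b A) : A = act I a b x := by
  classical
  ext j
  rw [act, Finset.mem_filter]
  constructor
  · intro h
    exact ⟨hA h, hx.1 j h⟩
  · rintro ⟨h1, h2⟩
    by_contra h
    exact (hx.2 j h1 h).ne h2

theorem mem_AA : A ∈ AA I a b ↔ A ⊆ I ∧ (cell I a b A).Nonempty := by
  classical
  unfold AA
  rw [Finset.mem_filter, Finset.mem_powerset]

theorem act_AA {x : Euc d} (hx : x ∈ HP I a b) : act I a b x ∈ AA I a b := by
  classical
  exact mem_AA.2 ⟨Finset.filter_subset _ _, x, act_cell hx⟩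

theorem cell_FA {x : Euc d} (hx : x ∈ cell I a b A) : x ∈ FA I a b A := by
  refine ⟨fun i hi => ?_, hx.1⟩
  by_cases h : i ∈ A
  · exact (hx.1 i h).le
  · exact (hx.2 i hi h).le

theorem FA_convex : Convex ℝ (FA I a b A) := by
  have : FA I a b A = HP I a b ∩ ⋂ i ∈ A, {x | ⟪a i, x⟫_ℝ = b i} := by
    ext x; simp [FA]
  rw [this]
  refine HP_convex.inter (convex_iInter₂ fun i _ => ?_)
  exact convex_hyperplane (innerₛₗ ℝ (a i)).isLinear (b i)

theorem FA_exposed (hA : A ∈ AA I a b) : IsExposed ℝ (HP I a b) (FA I a b A) := by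
  obtain ⟨hAI, p, hp⟩ := mem_AA.1 hA
  intro _
  refine ⟨innerSL ℝ (∑ j ∈ A, a j), ?_⟩
  ext x
  constructor
  · rintro ⟨hx, hxA⟩
    refine ⟨hx, fun y hy => ?_⟩
    simp only [innerSL_apply_apply, sum_inner]
    exact Finset.sum_le_sum fun j hj => (hy j (hAI hj)).trans_eq (hxA j hj).symm
  · rintro ⟨hx, hmax⟩
    refine ⟨hx, ?_⟩
    have h := hmax p (cell_FA hp).1
    simp only [innerSL_apply_apply, sum_inner] at h
    rw [Finset.sum_congr rfl hp.1] at h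
    have h2 : ∑ j ∈ A, ⟪a j, x⟫_ℝ = ∑ j ∈ A, b j :=
      le_antisymm (Finset.sum_le_sum fun j hj => hx j (hAI hj)) h
    exact (Finset.sum_eq_sum_iff_of_le fun j hj => hx j (hAI hj)).1 h2

theorem intrinsic_ext {F : Set (Euc d)} {p q : Euc d} (hq : q ∈ intrinsicInterior ℝ F)
    (hp : p ∈ F) : ∃ ε : ℝ, 0 < ε ∧ q + ε • (q - p) ∈ F := by
  obtain ⟨y, hy, rfl⟩ := hq
  have hp' : p ∈ affineSpan ℝ F := subset_affineSpan ℝ F hp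
  let g : ℝ → affineSpan ℝ F := fun t => ⟨AffineMap.lineMap p (y : Euc d) t,
    AffineMap.lineMap_mem t hp' y.2⟩
  have hg : Continuous g := by
    apply Continuous.subtype_mk
    exact AffineMap.lineMap_continuous
  have hg1 : g 1 = y := by
    apply Subtype.ext; simp [g]
  have h2 : ∀ᶠ t in nhds (1 : ℝ), g t ∈ interior ((↑) ⁻¹' F : Set (affineSpan ℝ F)) := by
    apply hg.continuousAt.eventually_mem
    rw [hg1]
    exact isOpen_interior.mem_nhds hy
  obtain ⟨ε, hε, H⟩ := Metric.eventually_nhds_iff.1 h2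
  refine ⟨ε / 2, by positivity, ?_⟩
  have h3 := interior_subset (H (y := 1 + ε / 2) (by
    rw [Real.dist_eq]; simp only [add_sub_cancel_left]; rw [abs_of_pos] <;> linarith))
  have h4 : ((g (1 + ε / 2) : affineSpan ℝ F) : Euc d) = y + (ε / 2) • ((y : Euc d) - p) := by
    simp only [g, AffineMap.lineMap_apply, vsub_eq_sub, vadd_eq_add, add_smul, one_smul]
    abel
  rw [← h4]
  exact h3

theorem relPt_mem {F : Set (Euc d)} (hF : Convex ℝ F) (hne : F.Nonempty) :
    relPt F ∈ intrinsicInterior ℝ F := by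
  have h := (intrinsicInterior_nonempty hF).2 hne
  unfold relPt
  rw [dif_pos h]
  exact h.some_mem

theorem relPt_cell (hA : A ∈ AA I a b) : relPt (FA I a b A) ∈ cell I a b A := by
  obtain ⟨hAI, p, hp⟩ := mem_AA.1 hA
  have hq := relPt_mem (FA_convex (I := I) (a := a) (b := b) (A := A)) ⟨p, cell_FA hp⟩
  have hqF := intrinsicInterior_subset hq
  refine ⟨hqF.2, fun j hj hjA => ?_⟩
  obtain ⟨ε, hε, h⟩ := intrinsic_ext hq (cell_FA hp)
  have h1 := h.1 j hj
  have h2 := hp.2 j hj hjA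
  rw [inner_add_right, real_inner_smul_right, inner_sub_right] at h1
  have h3 := mul_lt_mul_of_pos_left h2 hε
  by_contra hcon
  have h4 := not_lt.1 hcon
  have h5 := mul_le_mul_of_nonneg_left h4 hε.le
  nlinarith

theorem perturb_P (hA : A ⊆ I) {q : Euc d} (hq : q ∈ cell I a b A) (u : Euc d)
    (hu : ∀ j ∈ A, ⟪a j, u⟫_ℝ ≤ 0) : ∃ ε : ℝ, 0 < ε ∧ q + ε • u ∈ HP I a b := by
  obtain ⟨ε, hε, H⟩ := perturb (I \ A) a b q u
    (fun j hj => hq.2 j (Finset.mem_sdiff.1 hj).1 (Finset.mem_sdiff.1 hj).2)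
  refine ⟨ε, hε, fun j hj => ?_⟩
  by_cases h : j ∈ A
  · rw [inner_add_right, real_inner_smul_right, hq.1 j h]
    have := mul_nonneg hε.le (neg_nonneg.2 (hu j h))
    linarith
  · exact (H ε (by rw [abs_of_pos hε]) j (Finset.mem_sdiff.2 ⟨hj, h⟩)).le

theorem exposed_FA {F : Set (Euc d)} (hF : IsExposed ℝ (HP I a b) F) (hne : F.Nonempty) :
    ∃ A ∈ AA I a b, FA I a b A = F := by
  have hconv := hF.convex HP_convex
  have hq := relPt_mem hconv hne
  have hqF := intrinsicInterior_subset hq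
  set q := relPt F
  obtain ⟨l, hl⟩ := hF hne
  have hFP : F ⊆ HP I a b := hF.subset
  have hqP := hFP hqF
  have hqc := act_cell hqP
  have hA := act_AA hqP
  refine ⟨_, hA, ?_⟩
  ext y
  constructor
  · rintro ⟨hy, hyA⟩
    obtain ⟨ε, hε, h⟩ := perturb_P (mem_AA.1 hA).1 hqc (q - y) (fun j hj => by
      rw [inner_sub_right, hqc.1 j hj, hyA j hj, sub_self])
    have h1 : ∀ z ∈ HP I a b, l z ≤ l q := by
      rw [hl] at hqF; exact hqF.2
    have h2 := h1 _ h
    rw [map_add, map_smul, map_sub, smul_eq_mul] at h2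
    have h3 : l q ≤ l y := by
      by_contra hcon
      have := mul_pos hε (sub_pos.2 (not_le.1 hcon))
      linarith
    rw [hl]
    exact ⟨hy, fun z hz => (h1 z hz).trans h3⟩
  · intro hy
    refine ⟨hFP hy, fun j hj => ?_⟩
    obtain ⟨ε, hε, h⟩ := intrinsic_ext hq hy
    have hjI := (mem_AA.1 hA).1 hj
    have h1 := hFP h j hjI
    rw [inner_add_right, real_inner_smul_right, inner_sub_right, hqc.1 j hj] at h1
    refine le_antisymm (hFP hy j hjI) ?_
    by_contra hcon
    have := mul_pos hε (sub_pos.2 (not_le.1 hcon))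
    linarith

theorem FA_inj : Set.InjOn (FA I a b) (AA I a b : Set (Finset ι)) := by
  intro A hA B hB h
  have h1 := relPt_cell hA
  have h2 := relPt_cell hB
  rw [← h] at h2
  rw [cell_act (mem_AA.1 hA).1 h1, cell_act (mem_AA.1 hB).1 h2]

theorem innerCone_FA (hA : A ∈ AA I a b) (hP : vectorSpan ℝ (HP I a b) = ⊤) :
    innerCone (FA I a b A) (HP I a b) = dc (a '' (A : Set ι)) := by
  have hq := relPt_cell hA
  have hAI := (mem_AA.1 hA).1
  unfold innerCone
  rw [hP, Submodule.top_orthogonal_eq_bot, Submodule.bot_coe]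
  rw [show ({0} : Set (Euc d)) = 0 from rfl, add_zero]
  set q := relPt (FA I a b A)
  ext u
  constructor
  · rintro ⟨c, p, ⟨x, hx, rfl⟩, hc, rfl⟩
    rintro _ ⟨j, hj, rfl⟩
    have h1 := hx j (hAI hj)
    simp only [real_inner_smul_right, inner_sub_right, hq.1 j hj]
    exact mul_nonpos_of_nonneg_of_nonpos hc (by linarith)
  · intro hu
    obtain ⟨ε, hε, h⟩ := perturb_P hAI hq u (fun j hj => hu _ ⟨j, hj, rfl⟩)
    refine ⟨ε⁻¹, ε • u, ⟨q + ε • u, h, by simp⟩, by positivity, ?_⟩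
    rw [smul_smul, inv_mul_cancel₀ hε.ne', one_smul]

theorem sdim_FA (hA : A ∈ AA I a b) : rk a A + sdim (FA I a b A) = d := by
  obtain ⟨hAI, p, hp⟩ := mem_AA.1 hA
  have h1 : vectorSpan ℝ (FA I a b A) = (Submodule.span ℝ (a '' (A : Set ι)))ᗮ := by
    apply le_antisymm
    · rw [vectorSpan_def, Submodule.span_le]
      rintro _ ⟨x, hx, y, hy, rfl⟩
      rw [SetLike.mem_coe, Submodule.mem_orthogonal]
      intro v hv
      induction hv using Submodule.span_induction with
      | mem v hv =>
        obtain ⟨j, hj, rfl⟩ := hv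
        simp only [vsub_eq_sub, inner_sub_right]
        rw [hx.2 j hj, hy.2 j hj, sub_self]
      | zero => simp
      | add u v _ _ hu hv => rw [inner_add_left, hu, hv, add_zero]
      | smul r v _ hv => rw [real_inner_smul_left, hv, mul_zero]
    · intro u hu
      have hu' : ∀ j ∈ A, ⟪a j, u⟫_ℝ = 0 := fun j hj =>
        hu _ (Submodule.subset_span ⟨j, hj, rfl⟩)
      obtain ⟨ε, hε, h⟩ := perturb_P hAI hp u (fun j hj => (hu' j hj).le)
      have h2 : p + ε • u ∈ FA I a b A := ⟨h, fun j hj => by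
        rw [inner_add_right, real_inner_smul_right, hu' j hj, mul_zero, add_zero, hp.1 j hj]⟩
      have h3 := vsub_mem_vectorSpan ℝ h2 (cell_FA hp)
      rw [vsub_eq_sub, add_sub_cancel_left] at h3
      have h4 := Submodule.smul_mem _ ε⁻¹ h3
      rwa [smul_smul, inv_mul_cancel₀ hε.ne', one_smul] at h4
  unfold rk sdim
  rw [h1, Submodule.finrank_add_finrank_orthogonal]
  simp

theorem bridge (α : ConeAngle d) (hP : vectorSpan ℝ (HP I a b) = ⊤) (k : ℕ) :
    intAngleSum α (HP I a b) k =
      ∑ A ∈ (AA I a b).filter (fun A => rk a A + k = d), α.toFun (dc (a '' (A : Set ι))) := by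
  unfold intAngleSum
  rw [← finsum_mem_coe_finset]
  symm
  refine finsum_mem_eq_of_bijOn (FA I a b) ⟨?_, ?_, ?_⟩ ?_
  · intro A hA
    rw [Finset.mem_coe, Finset.mem_filter] at hA
    obtain ⟨hA, hk⟩ := hA
    refine ⟨FA_exposed hA, ?_, ?_⟩
    · obtain ⟨_, p, hp⟩ := mem_AA.1 hA
      exact ⟨p, cell_FA hp⟩
    · have := sdim_FA hA
      omega
  · exact FA_inj.mono (by
      intro A hA
      exact (Finset.mem_filter.1 hA).1)
  · rintro F ⟨hF, hne, hk⟩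
    obtain ⟨A, hA, rfl⟩ := exposed_FA hF hne
    refine ⟨A, ?_, rfl⟩
    rw [Finset.mem_coe, Finset.mem_filter]
    exact ⟨hA, by have := sdim_FA hA; omega⟩
  · intro A hA
    rw [Finset.mem_coe, Finset.mem_filter] at hA
    unfold intAngle
    rw [innerCone_FA hA.1 hP]

theorem rk_le (hA : A ∈ AA I a b) : rk a A ≤ d := by
  have := sdim_FA hA; omega

end bridge

section hrep

theorem polytope_HP {P : Set (Euc d)} (hP : IsPolytope P) :
    ∃ (n : ℕ) (I : Finset (Fin n)) (a : Fin n → Euc d) (b : Fin n → ℝ),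
      (∀ i ∈ I, a i ≠ 0) ∧ P = HP I a b := by
  classical
  obtain ⟨s, ⟨v0, hv0⟩, rfl⟩ := hP
  let F : Euc d → (Euc d × ℝ →ₗ[ℝ] ℝ) := fun v =>
    (innerₛₗ ℝ v).comp (LinearMap.fst ℝ (Euc d) ℝ) - LinearMap.snd ℝ (Euc d) ℝ
  have hF : ∀ v p, F v p = ⟪v, p.1⟫_ℝ - p.2 := fun v p => rfl
  obtain ⟨n, g, hg⟩ := FGc_dual (M := Euc d × ℝ) ((s.finite_toSet).image F)
  have hgQ : ∀ k, ∀ v ∈ s, ⟪v, (g k).1⟫_ℝ ≤ (g k).2 := by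
    intro k v hv
    have : g k ∈ {x : Euc d × ℝ | ∀ f ∈ F '' (s : Set (Euc d)), f x ≤ 0} := by
      rw [hg]
      exact ⟨fun i => if i = k then 1 else 0, fun i => by dsimp only; split_ifs <;> simp, by simp⟩
    have := this _ ⟨v, hv, rfl⟩
    rw [hF] at this
    linarith
  refine ⟨n, Finset.univ.filter (fun k => (g k).1 ≠ 0), fun k => (g k).1, fun k => (g k).2, ?_, ?_⟩
  · intro i hi
    exact (Finset.mem_filter.1 hi).2
  ext x
  constructor
  · intro hx k _
    have : convexHull ℝ (s : Set (Euc d)) ⊆ {x | ⟪(g k).1, x⟫_ℝ ≤ (g k).2} := by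
      refine convexHull_min ?_ (convex_halfSpace_le (innerₛₗ ℝ (g k).1).isLinear _)
      intro v hv
      have := hgQ k v hv
      rw [real_inner_comm] at this
      exact this
    exact this hx
  · intro hx
    have hx' : ∀ k, ⟪(g k).1, x⟫_ℝ ≤ (g k).2 := by
      intro k
      by_cases h : (g k).1 = 0
      · have := hgQ k v0 hv0
        rw [h, inner_zero_right] at this
        rw [h, inner_zero_left]
        exact this
      · exact hx k (Finset.mem_filter.2 ⟨Finset.mem_univ _, h⟩)
    by_contra hcon
    obtain ⟨f, u, hf1, hf2⟩ := geometric_hahn_banach_closed_point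
      (convex_convexHull ℝ (s : Set (Euc d)))
      (s.finite_toSet.isCompact_convexHull ℝ).isClosed hcon
    set c := (InnerProductSpace.toDual ℝ (Euc d)).symm f with hc
    have hcf : ∀ y, ⟪c, y⟫_ℝ = f y := fun y => by
      rw [hc, InnerProductSpace.toDual_symm_apply]
    have hmem : (c, u) ∈ {x : Euc d × ℝ | ∀ f ∈ F '' (s : Set (Euc d)), f x ≤ 0} := by
      rintro _ ⟨v, hv, rfl⟩
      rw [hF]
      have := hf1 v (subset_convexHull ℝ _ hv)
      rw [← hcf, real_inner_comm] at this
      simp only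
      linarith
    rw [hg] at hmem
    obtain ⟨t, ht, hsum⟩ := hmem
    have e1 : c = ∑ i, t i • (g i).1 := by
      have := congrArg Prod.fst hsum
      simpa [Prod.fst_sum] using this
    have e2 : u = ∑ i, t i * (g i).2 := by
      have := congrArg Prod.snd hsum
      simpa [Prod.snd_sum] using this
    have : ⟪c, x⟫_ℝ ≤ u := by
      rw [e1, e2, sum_inner]
      refine Finset.sum_le_sum fun i _ => ?_
      rw [real_inner_smul_left]
      exact mul_le_mul_of_nonneg_left (hx' i) (ht i)
    rw [hcf] at this
    linarith

variable {ι : Type*} [DecidableEq ι] {I : Finset ι} {a : ι → Euc d} {b : ι → ℝ}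

theorem HP_polytope (hb : Bornology.IsBounded (HP I a b)) (hne : (HP I a b).Nonempty) :
    IsPolytope (HP I a b) := by
  classical
  have hcomp : IsCompact (HP I a b) := Metric.isCompact_of_isClosed_isBounded HP_closed hb
  have hinj : Set.InjOn (act I a b) ((HP I a b).extremePoints ℝ) := by
    intro x hx y hy h
    have hxP := hx.1
    have hyP := hy.1
    have hxc := act_cell hxP
    have hyc := act_cell hyP
    rw [← h] at hyc
    obtain ⟨ε, hε, hz⟩ := perturb_P (mem_AA.1 (act_AA hxP)).1 hxc (x - y) (fun j hj => by
      rw [inner_sub_right, hxc.1 j hj, hyc.1 j hj, sub_self])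
    have hseg : x ∈ openSegment ℝ y (x + ε • (x - y)) := by
      refine ⟨ε / (1 + ε), 1 / (1 + ε), by positivity, by positivity, by field_simp; ring, ?_⟩
      have : x = (ε / (1 + ε) + 1 / (1 + ε)) • x := by
        rw [show ε / (1 + ε) + 1 / (1 + ε) = 1 by field_simp; ring, one_smul]
      conv_rhs => rw [this]
      module
    exact (hx.2 hyP hz hseg).symm
  have hfin : ((HP I a b).extremePoints ℝ).Finite := by
    refine Set.Finite.of_finite_image ?_ hinj
    refine (I.powerset.finite_toSet).subset ?_
    rintro _ ⟨x, hx, rfl⟩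
    exact Finset.mem_coe.2 (Finset.mem_powerset.2 (Finset.filter_subset _ _))
  have hKM := closure_convexHull_extremePoints hcomp HP_convex
  rw [(hfin.isCompact_convexHull ℝ).isClosed.closure_eq] at hKM
  refine ⟨hfin.toFinset, ?_, ?_⟩
  · rw [Set.Finite.toFinset_nonempty]
    exact hcomp.extremePoints_nonempty hne
  · rw [Set.Finite.coe_toFinset, hKM]

theorem sum_group (α : ConeAngle d) (hP : vectorSpan ℝ (HP I a b) = ⊤) (c : ℕ → ℝ) :
    ∑ k ∈ Finset.range (d + 1), c k * intAngleSum α (HP I a b) k =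
      ∑ A ∈ AA I a b, c (d - rk a A) * α.toFun (dc (a '' (A : Set ι))) := by
  rw [← Finset.sum_fiberwise_of_maps_to (s := AA I a b) (t := Finset.range (d + 1))
    (g := fun A => d - rk a A) (fun A _ => Finset.mem_range.2 (by omega))]
  refine Finset.sum_congr rfl fun k hk => ?_
  rw [bridge α hP, Finset.mul_sum]
  have hk' := Finset.mem_range.1 hk
  refine Finset.sum_congr ?_ ?_
  · ext A
    simp only [Finset.mem_filter]
    refine and_congr_right fun hA => ?_
    have := rk_le hA
    omega
  · intro A hA
    rw [(Finset.mem_filter.1 hA).2]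

theorem rk_zero {A : Finset ι} (hA : ∀ i ∈ A, a i ≠ 0) (h : rk a A = 0) : A = ∅ := by
  unfold rk at h
  rw [Submodule.finrank_eq_zero, Submodule.span_eq_bot] at h
  by_contra hne
  obtain ⟨i, hi⟩ := Finset.nonempty_iff_ne_empty.2 hne
  exact hA i hi (h _ ⟨i, hi, rfl⟩)

theorem angle_top (α : ConeAngle d) (ha : ∀ i ∈ I, a i ≠ 0) (hne : (HP I a b).Nonempty)
    (hP : vectorSpan ℝ (HP I a b) = ⊤) : intAngleSum α (HP I a b) d = 1 := by
  have hd : sdim (HP I a b) = d := by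
    unfold sdim; rw [hP]; simp
  obtain ⟨A, hA, hFA⟩ := exposed_FA (IsExposed.refl (𝕜 := ℝ) (A := HP I a b)) hne
  have h1 := sdim_FA hA
  rw [hFA, hd] at h1
  have hA0 : A = ∅ := rk_zero (fun i hi => ha i ((mem_AA.1 hA).1 hi)) (by omega)
  subst hA0
  rw [bridge α hP]
  have : (AA I a b).filter (fun A => rk a A + d = d) = {∅} := by
    ext B
    simp only [Finset.mem_filter, Finset.mem_singleton]
    constructor
    · rintro ⟨hB, h⟩
      exact rk_zero (fun i hi => ha i ((mem_AA.1 hB).1 hi)) (by omega)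
    · rintro rfl
      exact ⟨hA, by omega⟩
  rw [this, Finset.sum_singleton]
  simp [dc_empty, α.norm']

theorem vspan_top {P : Set (Euc d)} (h : sdim P = d) : vectorSpan ℝ P = ⊤ :=
  Submodule.eq_top_of_finrank_eq (by rw [← sdim, h]; simp)

theorem gram_range (α : ConeAngle d) {P : Set (Euc d)} (hP : IsPolytope P) (hd : sdim P = d) :
    ∑ k ∈ Finset.range d, (-1 : ℝ) ^ k * intAngleSum α P k = (-1) ^ (d + 1) := by
  have hbd : Bornology.IsBounded P := by
    obtain ⟨s, _, rfl⟩ := hP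
    exact (s.finite_toSet.isCompact_convexHull ℝ).isBounded
  have hne : P.Nonempty := by
    obtain ⟨s, hs, rfl⟩ := hP
    obtain ⟨v, hv⟩ := hs
    exact ⟨v, subset_convexHull ℝ _ hv⟩
  obtain ⟨n, I, a, b, ha, rfl⟩ := polytope_HP hP
  have hv := vspan_top hd
  have h1 := sum_group α hv (fun k => (-1 : ℝ) ^ k)
  rw [Finset.sum_range_succ, angle_top α ha hne hv] at h1
  have h2 : ∑ A ∈ AA I a b, (-1 : ℝ) ^ (d - rk a A) * α.toFun (dc (a '' (A : Set (Fin n)))) =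
      (-1 : ℝ) ^ d * Psi α I a b := by
    unfold Psi
    rw [Finset.mul_sum]
    refine Finset.sum_congr rfl fun A hA => ?_
    rw [← mul_assoc]
    congr 1
    have := rk_le hA
    generalize rk a A = r at this
    obtain ⟨m, rfl⟩ := Nat.exists_eq_add_of_le this
    rw [Nat.add_sub_cancel_left, pow_add, mul_right_comm, ← mul_pow]
    simp
  have h3 : Psi α I a b = 0 := by
    rw [gram_sys α _ I rfl a b ha]
    have : dc ((fun i => - a i) '' (I : Set (Fin n))) = {0} := by
      ext x
      rw [Set.mem_singleton_iff]
      constructor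
      · intro hx
        by_contra hx0
        obtain ⟨p, hp⟩ := hne
        obtain ⟨R, hR⟩ := hbd.exists_norm_le
        have hmem : ∀ t : ℝ, 0 ≤ t → p - t • x ∈ HP I a b := by
          intro t ht i hi
          have h4 := hx _ ⟨i, hi, rfl⟩
          rw [inner_neg_left] at h4
          rw [inner_sub_right, real_inner_smul_right]
          have := hp i hi
          have := mul_nonneg ht (show 0 ≤ ⟪a i, x⟫_ℝ by linarith)
          linarith
        have hx1 : 0 < ‖x‖ := norm_pos_iff.2 hx0
        have hR0 : 0 ≤ R := (norm_nonneg p).trans (hR p hp)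
        have h5 := hR _ (hmem ((2 * R + 1) / ‖x‖) (by positivity))
        have h6 : ‖((2 * R + 1) / ‖x‖) • x‖ = 2 * R + 1 := by
          rw [norm_smul, Real.norm_of_nonneg (by positivity)]
          field_simp
        have h7 := norm_sub_norm_le (((2 * R + 1) / ‖x‖) • x) p
        rw [norm_sub_rev] at h7
        have := hR p hp
        linarith
      · rintro rfl
        intro v _
        simp
    rw [this, α.zero']
  rw [h2, h3] at h1
  rw [pow_succ]
  linarith

end hrep

section block
variable {ι J : Type*} [Fintype ι] [DecidableEq ι] [Fintype J] [DecidableEq J]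

/-- A system of vectors decomposed into blocks, each block summing to zero, with no other
relations. -/
structure BlockSys (a : ι → Euc d) (p : ι → J) : Prop where
  ne : ∀ i, a i ≠ 0
  sum : ∀ B : J, ∑ i ∈ Finset.univ.filter (fun i => p i = B), a i = 0
  rel : ∀ c : ι → ℝ, ∑ i, c i • a i = 0 → ∀ i i', p i = p i' → c i = c i'
  span : ∀ x : Euc d, (∀ i, ⟪a i, x⟫_ℝ = 0) → x = 0
  surj : Function.Surjective p

variable {a : ι → Euc d} {p : ι → J}

theorem BlockSys.sum_inner (h : BlockSys a p) (B : J) (x : Euc d) :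
    ∑ i ∈ Finset.univ.filter (fun i => p i = B), ⟪a i, x⟫_ℝ = 0 := by
  rw [← _root_.sum_inner, h.sum, inner_zero_left]

theorem BlockSys.mem_AA_iff (h : BlockSys a p) (A : Finset ι) :
    A ∈ AA Finset.univ a (fun _ => 1) ↔ ∀ B, ∃ i, p i = B ∧ i ∉ A := by
  rw [mem_AA]
  constructor
  · rintro ⟨-, x, hx⟩ B
    by_contra! hcon
    have h1 := h.sum_inner B x
    rw [Finset.sum_congr rfl (g := fun _ => (1 : ℝ))
      (fun i hi => hx.1 i (hcon i (Finset.mem_filter.1 hi).2))] at h1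
    rw [Finset.sum_const, nsmul_eq_mul, mul_one, Nat.cast_eq_zero, Finset.card_eq_zero] at h1
    obtain ⟨i, hi⟩ := h.surj B
    have : i ∈ (∅ : Finset ι) := h1 ▸ Finset.mem_filter.2 ⟨Finset.mem_univ i, hi⟩
    simp at this
  · intro hA
    refine ⟨Finset.subset_univ _, ?_⟩
    let S : J → Finset ι := fun B => Finset.univ.filter (fun i => p i = B)
    let γ : ι → ℝ := fun i => if i ∈ A then 1 else
      - (((S (p i)).filter (fun j => j ∈ A)).card : ℝ) / ((S (p i)).filter (fun j => j ∉ A)).card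
    obtain ⟨x, hx⟩ := solve_lin Finset.univ a γ (by
      intro c hc
      have hrel := h.rel c hc
      rw [← Finset.sum_fiberwise_of_maps_to (g := p) (t := Finset.univ)
        (fun i _ => Finset.mem_univ _)]
      refine Finset.sum_eq_zero fun B _ => ?_
      obtain ⟨i0, hi0, hi0A⟩ := hA B
      have e1 : ∑ i ∈ Finset.univ.filter (fun i => p i = B), c i * γ i =
          c i0 * ∑ i ∈ S B, γ i := by
        rw [Finset.mul_sum]
        refine Finset.sum_congr rfl fun i hi => ?_
        rw [hrel i i0 ((Finset.mem_filter.1 hi).2.trans hi0.symm)]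
      rw [e1]
      have e2 : ∑ i ∈ S B, γ i = ∑ i ∈ S B, if i ∈ A then (1 : ℝ) else
          - (((S B).filter (fun j => j ∈ A)).card : ℝ) /
            ((S B).filter (fun j => j ∉ A)).card := by
        refine Finset.sum_congr rfl fun i hi => ?_
        simp only [γ]
        rw [(Finset.mem_filter.1 hi).2]
      rw [e2, Finset.sum_ite, Finset.sum_const, Finset.sum_const, nsmul_eq_mul, nsmul_eq_mul]
      have : (((S B).filter (fun j => j ∉ A)).card : ℝ) ≠ 0 := by
        rw [Nat.cast_ne_zero, Finset.card_ne_zero]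
        exact ⟨i0, Finset.mem_filter.2 ⟨Finset.mem_filter.2 ⟨Finset.mem_univ _, hi0⟩, hi0A⟩⟩
      rw [mul_div_cancel₀ _ this]
      simp)
    refine ⟨x, fun j hj => ?_, fun j _ hj => ?_⟩
    · rw [hx j (Finset.mem_univ _)]
      simp [γ, hj]
    · rw [hx j (Finset.mem_univ _)]
      simp only [γ, hj, if_false]
      rw [neg_div]
      have : (0 : ℝ) ≤ (((S (p j)).filter (fun j => j ∈ A)).card : ℝ) /
        ((S (p j)).filter (fun j => j ∉ A)).card := by positivity
      linarith

theorem BlockSys.rk_eq (h : BlockSys a p) {A : Finset ι}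
    (hA : A ∈ AA Finset.univ a (fun _ => 1)) : rk a A = A.card := by
  rw [h.mem_AA_iff] at hA
  apply rk_card
  intro c hc i hi
  have := h.rel (fun i => if i ∈ A then c i else 0) (by
    rw [← hc]
    simp only [ite_smul, zero_smul]
    rw [Finset.sum_ite_mem, Finset.univ_inter])
  obtain ⟨i0, hi0, hi0A⟩ := hA (p i)
  have := this i i0 hi0.symm
  simpa [hi, hi0A] using this

theorem BlockSys.bdd (h : BlockSys a p) :
    Bornology.IsBounded (HP Finset.univ a (fun _ => 1)) := by
  let T : Euc d →ₗ[ℝ] (ι → ℝ) := LinearMap.pi (fun i => innerₛₗ ℝ (a i))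
  have hT : Function.Injective T := by
    rw [injective_iff_map_eq_zero]
    intro x hx
    exact h.span x fun i => congrFun hx i
  have hemb := LinearMap.isClosedEmbedding_of_injective (LinearMap.ker_eq_bot.2 hT)
  have hc := hemb.isCompact_preimage
    (isCompact_univ_pi (fun _ : ι => isCompact_Icc (a := -(Fintype.card ι : ℝ)) (b := 1)))
  refine hc.isBounded.subset ?_
  intro x hx
  rw [Set.mem_preimage, Set.mem_univ_pi]
  intro i
  refine ⟨?_, hx i (Finset.mem_univ _)⟩
  have h1 := h.sum_inner (p i) x
  have hi : i ∈ Finset.univ.filter (fun j => p j = p i) := by simp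
  rw [← Finset.add_sum_erase _ _ hi] at h1
  have h2 : ∑ j ∈ (Finset.univ.filter (fun j => p j = p i)).erase i, ⟪a j, x⟫_ℝ ≤
      Fintype.card ι := by
    refine (Finset.sum_le_card_nsmul _ _ 1 (fun j _ => hx j (Finset.mem_univ _))).trans ?_
    rw [nsmul_eq_mul, mul_one, Nat.cast_le]
    exact Finset.card_le_univ _
  have h3 : T x i = ⟪a i, x⟫_ℝ := rfl
  rw [h3]
  linarith

theorem BlockSys.empty_mem (h : BlockSys a p) : ∅ ∈ AA Finset.univ a (fun _ => 1) := by
  rw [h.mem_AA_iff]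
  intro B
  obtain ⟨i, hi⟩ := h.surj B
  exact ⟨i, hi, by simp⟩

theorem BlockSys.sdim_eq (h : BlockSys a p) : sdim (HP Finset.univ a (fun _ => 1)) = d := by
  have h1 := sdim_FA h.empty_mem
  rw [h.rk_eq h.empty_mem] at h1
  have h2 : FA Finset.univ a (fun _ => 1) ∅ = HP Finset.univ a (fun _ => 1) := by
    ext x; simp [FA]
  rw [h2] at h1
  simpa using h1

theorem BlockSys.polytope (h : BlockSys a p) : IsPolytope (HP Finset.univ a (fun _ => 1)) := by
  refine HP_polytope h.bdd ⟨0, fun i _ => ?_⟩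
  simp

theorem BlockSys.w_sub (h : BlockSys a p) (α : ConeAngle d) {N : Finset ι} {B : J}
    (hN : ∀ i, p i = B → i ∈ N) : wch α a ∅ Finset.univ N = 0 := by
  obtain ⟨i0, hi0⟩ := h.surj B
  unfold wch
  refine alpha_flat α (((Set.finite_empty).union (N.finite_toSet.image _)).union
    ((Finset.finite_toSet _).image _)) (h.ne i0) ?_
  intro x hx
  refine (Finset.sum_eq_zero_iff_of_nonpos ?_).1 (h.sum_inner B x) i0 (by simp [hi0])
  intro i hi
  exact hx _ (Or.inl (Or.inr ⟨i, hN i (Finset.mem_filter.1 hi).2, rfl⟩))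

theorem BlockSys.w_miss (h : BlockSys a p) (α : ConeAngle d) {N : Finset ι} {B : J}
    (hN : ∀ i, p i = B → i ∉ N) : wch α a ∅ Finset.univ N = 0 := by
  obtain ⟨i0, hi0⟩ := h.surj B
  unfold wch
  refine alpha_flat α (((Set.finite_empty).union (N.finite_toSet.image _)).union
    ((Finset.finite_toSet _).image _)) (h.ne i0) ?_
  intro x hx
  refine (Finset.sum_eq_zero_iff_of_nonneg ?_).1 (h.sum_inner B x) i0 (by simp [hi0])
  intro i hi
  have := hx _ (Or.inr ⟨i, by simpa using hN i (Finset.mem_filter.1 hi).2, rfl⟩)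
  rw [inner_neg_left] at this
  linarith

/-- Binomial transform. -/
def hbin (d : ℕ) (c : ℕ → ℝ) (m : ℕ) : ℝ :=
  ∑ j ∈ Finset.range (m + 1), (m.choose j : ℝ) * c (d - j)

theorem BlockSys.total (h : BlockSys a p) (α : ConeAngle d) (c : ℕ → ℝ)
    (hc : ∀ m, Fintype.card J < m → m ≤ d → hbin d c m = 0) :
    ∑ k ∈ Finset.range (d + 1), c k * intAngleSum α (HP Finset.univ a (fun _ => 1)) k =
      hbin d c (Fintype.card J) * ∑ N ∈ (Finset.univ : Finset (Finset ι)).filter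
        (fun N => N.card = Fintype.card J), wch α a ∅ Finset.univ N := by
  classical
  rw [sum_group α (vspan_top h.sdim_eq)]
  have h1 : ∀ A ∈ AA Finset.univ a (fun _ => 1),
      c (d - rk a A) * α.toFun (dc (a '' (A : Set ι))) =
      ∑ N ∈ (Finset.univ : Finset ι).powerset,
        if A ⊆ N then c (d - A.card) * wch α a ∅ Finset.univ N else 0 := by
    intro A hA
    have := alpha_up α a (I := Finset.univ) (fun i _ => h.ne i) (V := ∅) Set.finite_empty
      (Finset.subset_univ A)
    rw [Set.empty_union] at this
    rw [h.rk_eq hA, this, Finset.mul_sum]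
    refine Finset.sum_congr rfl fun N _ => ?_
    split_ifs <;> simp
  rw [Finset.sum_congr rfl h1, Finset.sum_comm, Finset.powerset_univ, Finset.mul_sum,
    Finset.sum_filter]
  refine Finset.sum_congr rfl fun N _ => ?_
  by_cases hN : N ∈ AA Finset.univ a (fun _ => 1)
  · have h2 : (∑ A ∈ AA Finset.univ a (fun _ => 1),
        if A ⊆ N then c (d - A.card) * wch α a ∅ Finset.univ N else 0) =
        hbin d c N.card * wch α a ∅ Finset.univ N := by
      rw [← Finset.sum_filter]
      have : (AA Finset.univ a (fun _ => 1)).filter (fun A => A ⊆ N) = N.powerset := by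
        ext A
        rw [Finset.mem_filter, Finset.mem_powerset]
        refine ⟨fun h => h.2, fun hAN => ⟨?_, hAN⟩⟩
        rw [h.mem_AA_iff] at hN ⊢
        intro B
        obtain ⟨i, hi, hiN⟩ := hN B
        exact ⟨i, hi, fun hA => hiN (hAN hA)⟩
      rw [this, ← Finset.sum_mul, Finset.sum_powerset_apply_card (fun m => c (d - m))]
      simp [hbin]
    rw [h2]
    rcases lt_trichotomy N.card (Fintype.card J) with hlt | heq | hgt
    · rw [if_neg hlt.ne]
      have : ∃ B, ∀ i, p i = B → i ∉ N := by
        by_contra! hcon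
        have : (Finset.univ : Finset J) ⊆ N.image p := by
          intro B _
          obtain ⟨i, hi, hiN⟩ := hcon B
          exact Finset.mem_image.2 ⟨i, hiN, hi⟩
        have := (Finset.card_le_card this).trans Finset.card_image_le
        rw [Finset.card_univ] at this
        omega
      obtain ⟨B, hB⟩ := this
      rw [h.w_miss α hB, mul_zero]
    · rw [if_pos heq, heq]
    · rw [if_neg hgt.ne', hc _ hgt, zero_mul]
      rw [← h.rk_eq hN]
      exact rk_le hN
  · have hw : wch α a ∅ Finset.univ N = 0 := by
      rw [h.mem_AA_iff] at hN
      push Not at hN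
      obtain ⟨B, hB⟩ := hN
      exact h.w_sub α hB
    simp [hw]

end block

section perm

theorem mem_dc_union {U V : Set (Euc d)} {x : Euc d} : x ∈ dc (U ∪ V) ↔ x ∈ dc U ∧ x ∈ dc V := by
  simp only [mem_dc, Set.mem_union]
  constructor
  · intro h
    exact ⟨fun v hv => h v (Or.inl hv), fun v hv => h v (Or.inr hv)⟩
  · rintro ⟨h1, h2⟩ v (hv | hv)
    · exact h1 v hv
    · exact h2 v hv

theorem mem_dc_insert {V : Set (Euc d)} {x v : Euc d} :
    x ∈ dc (insert v V) ↔ ⟪v, x⟫_ℝ ≤ 0 ∧ x ∈ dc V := by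
  simp only [mem_dc, Set.mem_insert_iff, forall_eq_or_imp]

theorem mem_dc_image {κ : Type*} {f : κ → Euc d} {S : Set κ} {x : Euc d} :
    x ∈ dc (f '' S) ↔ ∀ i ∈ S, ⟪f i, x⟫_ℝ ≤ 0 := by
  simp only [mem_dc, Set.forall_mem_image]

theorem mem_dc_range {κ : Type*} {f : κ → Euc d} {x : Euc d} :
    x ∈ dc (Set.range f) ↔ ∀ i, ⟪f i, x⟫_ℝ ≤ 0 := by
  simp only [mem_dc, Set.forall_mem_range]

theorem max_lemma {κ : Type*} [DecidableEq κ] (α : ConeAngle d) (y : κ → Euc d)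
    (hy : Function.Injective y) (Y : Finset κ) (hY : Y.Nonempty) :
    ∀ V : Set (Euc d), V.Finite →
    ∑ q ∈ Y, α.toFun (dc (V ∪ (fun i => y i - y q) '' (Y : Set κ))) = α.toFun (dc V) := by
  induction hY using Finset.Nonempty.cons_induction with
  | singleton q =>
    intro V hV
    rw [Finset.sum_singleton]
    congr 1
    ext x
    simp [mem_dc_union, mem_dc]
  | cons q Y hq hY IH =>
    intro V hV
    rw [Finset.sum_cons, ← IH V hV, Finset.cons_eq_insert]
    have h1 : ∀ r ∈ Y, α.toFun (dc (V ∪ (fun i => y i - y r) '' (Y : Set κ))) =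
        α.toFun (dc (V ∪ (fun i => y i - y r) '' ((insert q Y : Finset κ) : Set κ))) +
        α.toFun (dc ((V ∪ (fun i => y i - y q) '' (Y : Set κ)) ∪
          (fun i => y i - y r) '' (Y : Set κ))) := by
      intro r hr
      have hne : y q - y r ≠ 0 := by
        rw [sub_ne_zero]
        intro h
        exact hq (hy h ▸ hr)
      rw [alpha_cut α (hV.union (Y.finite_toSet.image _)) hne]
      congr 2
      · congr 1
        rw [Finset.coe_insert, Set.image_insert_eq, Set.union_insert]
      · ext x
        rw [mem_dc_insert, mem_dc_union, mem_dc_union, mem_dc_union, mem_dc_image, mem_dc_image,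
          neg_sub]
        constructor
        · rintro ⟨h1, h2, h3⟩
          refine ⟨⟨h2, fun i hi => ?_⟩, h3⟩
          have := h3 i hi
          rw [inner_sub_left] at *
          linarith
        · rintro ⟨⟨h1, h2⟩, h3⟩
          exact ⟨h2 r hr, h1, h3⟩
    rw [Finset.sum_congr rfl h1, Finset.sum_add_distrib, add_comm,
      IH _ (hV.union (Y.finite_toSet.image _))]
    congr 2
    ext x
    rw [mem_dc_union, mem_dc_union, mem_dc_image, mem_dc_image]
    simp

theorem perm_lemma (α : ConeAngle d) : ∀ (k : ℕ) (y : Fin (k + 1) → Euc d)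
    (_ : Function.Injective y) (V : Set (Euc d)) (_ : V.Finite),
    ∑ τ : Equiv.Perm (Fin (k + 1)), α.toFun (dc (V ∪
      Set.range (fun m : Fin k => y (τ m.succ) - y (τ m.castSucc)))) = α.toFun (dc V) := by
  intro k
  induction k with
  | zero =>
    intro y hy V hV
    have hu : (Finset.univ : Finset (Equiv.Perm (Fin (0 + 1)))) = {1} := by
      ext τ
      simp only [Finset.mem_univ, Finset.mem_singleton, true_iff]
      ext m
      omega
    rw [hu, Finset.sum_singleton]
    congr 1
    ext x
    rw [mem_dc_union, mem_dc_range]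
    exact ⟨fun h => h.1, fun h => ⟨h, fun m => m.elim0⟩⟩
  | succ k IH =>
    intro y hy V hV
    rw [← Equiv.sum_comp Equiv.Perm.decomposeFin.symm, Fintype.sum_prod_type]
    rw [← max_lemma α y hy Finset.univ Finset.univ_nonempty V hV]
    refine Finset.sum_congr rfl fun q _ => ?_
    rw [← IH (fun m => y (Equiv.swap 0 q m.succ)) (fun m m' h => by
      have := (Equiv.swap 0 q).injective (hy h)
      exact Fin.succ_injective _ this) (V ∪ (fun i => y i - y q) ''
        ((Finset.univ : Finset (Fin (k + 1 + 1))) : Set (Fin (k + 1 + 1))))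
      (hV.union ((Finset.finite_toSet _).image _))]
    refine Finset.sum_congr rfl fun e _ => ?_
    congr 1
    ext x
    set τ := Equiv.Perm.decomposeFin.symm (q, e) with hτ
    have t0 : τ 0 = q := Equiv.Perm.decomposeFin_symm_apply_zero q e
    have ts : ∀ m, τ (Fin.succ m) = Equiv.swap 0 q (e m).succ :=
      fun m => Equiv.Perm.decomposeFin_symm_apply_succ e q m
    rw [mem_dc_union, mem_dc_union, mem_dc_union, mem_dc_range, mem_dc_range, mem_dc_image]
    simp only [inner_sub_left, sub_nonpos, ← ts]
    constructor
    · rintro ⟨h1, h2⟩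
      have hanti : Antitone (fun m => ⟪y (τ m), x⟫_ℝ) := Fin.antitone_iff_succ_le.2 h2
      refine ⟨⟨h1, fun i _ => ?_⟩, fun m => ?_⟩
      · have := hanti (Fin.zero_le (τ.symm i))
        simpa [t0] using this
      · have := h2 m.succ
        rwa [← Fin.succ_castSucc] at this
    · rintro ⟨⟨h1, h2⟩, h3⟩
      refine ⟨h1, fun m => ?_⟩
      induction m using Fin.cases with
      | zero =>
        rw [Fin.castSucc_zero, t0]
        exact h2 _ (by simp)
      | succ m =>
        rw [← Fin.succ_castSucc]
        exact h3 m

end perm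

section family
variable {k n : ℕ}

/-- Vertices of the standard simplex. -/
def yv (f : Fin k ⊕ Fin n → Euc d) : Fin (k + 1) → Euc d :=
  Fin.cons 0 (fun j => f (Sum.inl j))

/-- Normals: a cyclic simplex system times slabs. -/
def av (f : Fin k ⊕ Fin n → Euc d) (σ : Equiv.Perm (Fin (k + 1))) :
    Fin (k + 1) ⊕ (Fin n ⊕ Fin n) → Euc d :=
  Sum.elim (fun i => yv f (σ i) - yv f (σ (i + 1)))
    (Sum.elim (fun j => f (Sum.inr j)) (fun j => - f (Sum.inr j)))

/-- Blocks. -/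
def pv (k n : ℕ) : Fin (k + 1) ⊕ (Fin n ⊕ Fin n) → Option (Fin n) :=
  Sum.elim (fun _ => none) (Sum.elim some some)

theorem const_fin {g : Fin (k + 1) → ℝ} (h : ∀ i, g (i + 1) = g i) (i : Fin (k + 1)) :
    g i = g 0 := by
  induction i using Fin.induction with
  | zero => rfl
  | succ i ih => rw [← Fin.coeSucc_eq_succ, h, ih]

theorem yv_inj {f : Fin k ⊕ Fin n → Euc d} (hf : LinearIndependent ℝ f) :
    Function.Injective (yv f) := by
  unfold yv
  rw [Fin.cons_injective_iff]
  constructor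
  · rintro ⟨j, hj⟩
    exact hf.ne_zero _ hj
  · intro i j h
    exact Sum.inl_injective (hf.injective h)

theorem fin_add_one_ne (hk : 0 < k) (i : Fin (k + 1)) : i ≠ i + 1 := by
  intro h
  have h0 : (1 : Fin (k + 1)) = 0 := by
    have := h.symm
    simpa using this
  have := congrArg Fin.val h0
  rw [Fin.val_one', Fin.val_zero, Nat.mod_eq_of_lt (by omega)] at this
  omega

theorem av_rel {f : Fin k ⊕ Fin n → Euc d} (hf : LinearIndependent ℝ f)
    (σ : Equiv.Perm (Fin (k + 1))) (c : Fin (k + 1) ⊕ (Fin n ⊕ Fin n) → ℝ)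
    (hc : ∑ i, c i • av f σ i = 0) (i i' : Fin (k + 1) ⊕ (Fin n ⊕ Fin n))
    (hi : pv k n i = pv k n i') : c i = c i' := by
  let u : Fin (k + 1) → ℝ := fun i => c (Sum.inl i)
  let g : Fin (k + 1) → ℝ := fun m => u (σ.symm m) - u (σ.symm m - 1)
  have e1 : ∑ i, u i • (yv f (σ i) - yv f (σ (i + 1))) = ∑ m, g m • yv f m := by
    rw [← Equiv.sum_comp σ (fun m => g m • yv f m)]
    have : ∑ i, u i • yv f (σ (i + 1)) = ∑ i, u (i - 1) • yv f (σ i) := by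
      rw [← Equiv.sum_comp (Equiv.addRight (1 : Fin (k + 1))) (fun i => u (i - 1) • yv f (σ i))]
      simp
    simp only [smul_sub, Finset.sum_sub_distrib, g, sub_smul, Equiv.symm_apply_apply, this]
  have e2 : ∑ m, g m • yv f m = ∑ j : Fin k, g j.succ • f (Sum.inl j) := by
    rw [Fin.sum_univ_succ]
    simp [yv]
  have hc2 : ∑ t, (Sum.elim (fun j : Fin k => g j.succ)
      (fun j : Fin n => c (Sum.inr (Sum.inl j)) - c (Sum.inr (Sum.inr j)))) t • f t = 0 := by
    rw [Fintype.sum_sum_type]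
    simp only [Sum.elim_inl, Sum.elim_inr]
    rw [← e2, ← e1, ← hc, Fintype.sum_sum_type, Fintype.sum_sum_type]
    simp only [av, Sum.elim_inl, Sum.elim_inr, u, sub_smul, smul_neg, Finset.sum_sub_distrib,
      Finset.sum_neg_distrib]
    abel
  have hz := Fintype.linearIndependent_iff.1 hf _ hc2
  have hs : ∀ j, c (Sum.inr (Sum.inl j)) = c (Sum.inr (Sum.inr j)) := fun j => by
    have := hz (Sum.inr j)
    simp only [Sum.elim_inr] at this
    linarith
  have hg : ∀ j : Fin k, g j.succ = 0 := fun j => hz (Sum.inl j)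
  have hgs : ∑ m, g m = 0 := by
    rw [← Equiv.sum_comp σ]
    simp only [g, Equiv.symm_apply_apply, Finset.sum_sub_distrib]
    rw [← Equiv.sum_comp (Equiv.addRight (1 : Fin (k + 1))) (fun i => u (i - 1))]
    simp
  have hg0 : g 0 = 0 := by
    rw [Fin.sum_univ_succ] at hgs
    simpa [hg] using hgs
  have hgall : ∀ m, g m = 0 := fun m => by
    induction m using Fin.cases with
    | zero => exact hg0
    | succ j => exact hg j
  have hu : ∀ i, u (i + 1) = u i := fun i => by
    have := hgall (σ (i + 1))
    simp only [g, Equiv.symm_apply_apply, add_sub_cancel_right] at this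
    linarith
  have hu0 : ∀ i, c (Sum.inl i) = u 0 := fun i => const_fin hu i
  rcases i with i | i | i <;> rcases i' with i' | i' | i' <;> simp [pv] at hi
  · rw [hu0, hu0]
  · rw [hi]
  · rw [hi, hs]
  · rw [hi, hs]
  · rw [hi]

theorem av_block {f : Fin k ⊕ Fin n → Euc d} (hk : 0 < k) (hf : LinearIndependent ℝ f)
    (hsp : ∀ x : Euc d, (∀ t, ⟪f t, x⟫_ℝ = 0) → x = 0) (σ : Equiv.Perm (Fin (k + 1))) :
    BlockSys (av f σ) (pv k n) where
  ne := by
    rintro (i | j | j)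
    · simp only [av, Sum.elim_inl]
      rw [sub_ne_zero]
      intro h
      exact fin_add_one_ne hk i (σ.injective (yv_inj hf h))
    · simpa [av] using hf.ne_zero (Sum.inr j)
    · simpa [av] using hf.ne_zero (Sum.inr j)
  sum := by
    intro B
    rw [Finset.sum_filter, Fintype.sum_sum_type, Fintype.sum_sum_type]
    rcases B with _ | j
    · simp only [pv, av, Sum.elim_inl, Sum.elim_inr]
      simp only [if_true, reduceCtorEq, if_false, Finset.sum_const_zero, add_zero,
        Finset.sum_sub_distrib]
      rw [← Equiv.sum_comp (Equiv.addRight (1 : Fin (k + 1))) (fun i => yv f (σ i))]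
      simp
    · simp [pv, av]
  rel := fun c hc i i' hi => av_rel hf σ c hc i i' hi
  span := by
    intro x hx
    have h1 : ∀ i, ⟪yv f (σ (i + 1)), x⟫_ℝ = ⟪yv f (σ i), x⟫_ℝ := fun i => by
      have := hx (Sum.inl i)
      simp only [av, Sum.elim_inl, inner_sub_left] at this
      linarith
    have h2 := const_fin (g := fun i => ⟪yv f (σ i), x⟫_ℝ) h1
    have h3 : ∀ m, ⟪yv f m, x⟫_ℝ = 0 := fun m => by
      have e1 := h2 (σ.symm m)
      have e2 := h2 (σ.symm 0)
      simp only [Equiv.apply_symm_apply] at e1 e2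
      rw [e1, ← e2]
      simp [yv]
    apply hsp
    rintro (j | j)
    · simpa [yv] using h3 j.succ
    · simpa [av] using hx (Sum.inr (Sum.inl j))
  surj := by
    rintro (_ | j)
    · exact ⟨Sum.inl 0, rfl⟩
    · exact ⟨Sum.inr (Sum.inl j), rfl⟩

theorem cyc_iff (g : Fin (k + 1) → ℝ) (i : Fin (k + 1)) :
    (g i ≤ g (i + 1) ∧ ∀ i', i' ≠ i → g (i' + 1) ≤ g i') ↔
      ∀ m : Fin k, g (m.succ + (i + 1)) ≤ g (m.castSucc + (i + 1)) := by
  constructor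
  · rintro ⟨-, h⟩ m
    have := h (m.castSucc + (i + 1)) (by
      intro h
      have h2 : m.castSucc + 1 = 0 := by
        have h3 : (m.castSucc + 1) + i = 0 + i := by rw [add_assoc, add_comm 1 i, h, zero_add]
        exact add_right_cancel h3
      rw [Fin.coeSucc_eq_succ] at h2
      exact Fin.succ_ne_zero _ h2)
    rwa [add_right_comm, Fin.coeSucc_eq_succ] at this
  · intro h
    have hanti : Antitone (fun m : Fin (k + 1) => g (m + (i + 1))) :=
      Fin.antitone_iff_succ_le.2 h
    constructor
    · have := hanti (Fin.zero_le (Fin.last k))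
      simp only [zero_add] at this
      rwa [add_comm i 1, ← add_assoc, Fin.last_add_one, zero_add, add_comm 1 i] at this
    · intro i' hi'
      have hne : i' - (i + 1) ≠ Fin.last k := by
        intro h2
        apply hi'
        rw [sub_eq_iff_eq_add, add_comm i 1, ← add_assoc, Fin.last_add_one, zero_add] at h2
        exact h2
      obtain ⟨m, hm⟩ := Fin.exists_castSucc_eq.2 hne
      have := h m
      rw [← Fin.coeSucc_eq_succ, hm, add_right_comm, sub_add_cancel] at this
      exact this

/-- The transversal with given choices. -/
def trv (q : Fin (k + 1) × Finset (Fin n)) : Finset (Fin (k + 1) ⊕ (Fin n ⊕ Fin n)) :=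
  Finset.disjSum {q.1} (Finset.disjSum q.2 q.2ᶜ)

theorem wch_trv (α : ConeAngle d) (f : Fin k ⊕ Fin n → Euc d) (σ : Equiv.Perm (Fin (k + 1)))
    (i : Fin (k + 1)) (S : Finset (Fin n)) :
    wch α (av f σ) ∅ Finset.univ (trv (i, S)) =
      α.toFun (dc (Set.range (fun m : Fin k => yv f (σ (m.succ + (i + 1))) -
        yv f (σ (m.castSucc + (i + 1)))) ∪ (fun j => f (Sum.inr j)) '' (S : Set (Fin n)) ∪
        (fun j => - f (Sum.inr j)) '' ((Finset.univ \ S : Finset (Fin n)) : Set (Fin n)))) := by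
  unfold wch
  congr 1
  ext x
  rw [mem_dc_union, mem_dc_union, mem_dc_union, mem_dc_union, mem_dc_image, mem_dc_image,
    mem_dc_image, mem_dc_image, mem_dc_range]
  have hcyc := cyc_iff (fun i => ⟪yv f (σ i), x⟫_ℝ) i
  simp only [inner_sub_left, sub_nonpos]
  rw [← hcyc]
  simp only [trv, Finset.mem_coe, Sum.forall, Finset.inl_mem_disjSum, Finset.inr_mem_disjSum,
    av, Sum.elim_inl, Sum.elim_inr, Finset.mem_sdiff, Finset.mem_univ, true_and, inner_sub_left,
    inner_neg_left, neg_neg, Finset.mem_singleton, Finset.mem_compl, sub_nonpos, neg_sub,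
    forall_eq, mem_dc, Set.mem_empty_iff_false, not_not, false_imp_iff, implies_true, neg_le_neg_iff, neg_nonpos]
  constructor
  · rintro ⟨⟨h1, h2, h3⟩, h4, h5, h6⟩
    refine ⟨⟨⟨h1, fun i' hi' => ?_⟩, h2⟩, h3⟩
    have := h4 i' hi'
    linarith
  · rintro ⟨⟨⟨h1, h4⟩, h2⟩, h3⟩
    refine ⟨⟨h1, h2, h3⟩, fun i' hi' => ?_, h3, fun j hj => ?_⟩
    · have := h4 i' hi'
      linarith
    · have := h2 j hj
      linarith

theorem sum_trv {f : Fin k ⊕ Fin n → Euc d} (α : ConeAngle d) (hf : LinearIndependent ℝ f)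
    {σ : Equiv.Perm (Fin (k + 1))} (hB : BlockSys (av f σ) (pv k n)) :
    ∑ N ∈ (Finset.univ : Finset (Finset (Fin (k + 1) ⊕ (Fin n ⊕ Fin n)))).filter
        (fun N => N.card = Fintype.card (Option (Fin n))), wch α (av f σ) ∅ Finset.univ N =
      ∑ i : Fin (k + 1), α.toFun (dc (Set.range (fun m : Fin k => yv f (σ (m.succ + (i + 1))) -
        yv f (σ (m.castSucc + (i + 1)))))) := by
  have h1 : ∀ i : Fin (k + 1), α.toFun (dc (Set.range (fun m : Fin k =>
      yv f (σ (m.succ + (i + 1))) - yv f (σ (m.castSucc + (i + 1)))))) =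
      ∑ S : Finset (Fin n), wch α (av f σ) ∅ Finset.univ (trv (i, S)) := by
    intro i
    rw [alpha_decomp α (fun j => f (Sum.inr j)) Finset.univ (fun j _ => hf.ne_zero _)
      (Set.finite_range _), Finset.powerset_univ]
    exact Finset.sum_congr rfl fun S _ => (wch_trv α f σ i S).symm
  rw [Finset.sum_congr rfl fun i _ => h1 i, ← Fintype.sum_prod_type'
    (f := fun i S => wch α (av f σ) ∅ Finset.univ (trv (i, S)))]
  symm
  refine Finset.sum_of_injOn trv ?_ ?_ ?_ (fun _ _ => rfl)
  · rintro ⟨i, S⟩ _ ⟨i', S'⟩ _ h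
    have e1 : i = i' := by
      have : Sum.inl i ∈ trv (i, S) := by simp [trv]
      rw [h] at this
      simpa [trv] using this
    have e2 : S = S' := by
      ext j
      have : Sum.inr (Sum.inl j) ∈ trv (i, S) ↔ Sum.inr (Sum.inl j) ∈ trv (i', S') := by rw [h]
      simpa [trv] using this
    rw [e1, e2]
  · rintro ⟨i, S⟩ _
    simp only [Finset.coe_filter, Finset.mem_univ, true_and, Set.mem_setOf_eq, trv,
      Finset.card_disjSum, Finset.card_singleton, Fintype.card_option, Fintype.card_fin]
    have := Finset.card_add_card_compl S
    rw [Fintype.card_fin] at this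
    omega
  · intro N hN hNi
    by_contra hw
    have hmiss : ∀ B, ∃ i, pv k n i = B ∧ i ∈ N := by
      intro B
      by_contra! hcon
      exact hw (hB.w_miss α hcon)
    have hsub : ∀ B, ∃ i, pv k n i = B ∧ i ∉ N := by
      intro B
      by_contra! hcon
      exact hw (hB.w_sub α hcon)
    have hN3 : N.toRight.toRight = (N.toRight.toLeft)ᶜ := by
      ext j
      rw [Finset.mem_compl, Finset.mem_toRight, Finset.mem_toRight, Finset.mem_toLeft,
        Finset.mem_toRight]
      obtain ⟨t, ht, htN⟩ := hmiss (some j)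
      obtain ⟨t', ht', htN'⟩ := hsub (some j)
      rcases t with t | t | t <;> rcases t' with t' | t' | t' <;> simp [pv] at ht ht' <;>
        subst ht <;> subst ht' <;> tauto
    have hdec : N = Finset.disjSum N.toLeft (Finset.disjSum N.toRight.toLeft
        (N.toRight.toLeft)ᶜ) := by
      rw [← hN3, Finset.toLeft_disjSum_toRight, Finset.toLeft_disjSum_toRight]
    have hcard := (Finset.mem_filter.1 hN).2
    rw [hdec, Finset.card_disjSum, Finset.card_disjSum, Finset.card_add_card_compl,
      Fintype.card_option, Fintype.card_fin] at hcard
    obtain ⟨i, hi⟩ := Finset.card_eq_one.1 (show N.toLeft.card = 1 by omega)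
    apply hNi
    refine ⟨(i, N.toRight.toLeft), by simp, ?_⟩
    conv_rhs => rw [hdec, hi]
    rfl

theorem exists_good {f : Fin k ⊕ Fin n → Euc d} (α : ConeAngle d) (hk : 0 < k)
    (hf : LinearIndependent ℝ f)
    (hsp : ∀ x : Euc d, (∀ t, ⟪f t, x⟫_ℝ = 0) → x = 0) :
    ∃ σ : Equiv.Perm (Fin (k + 1)),
      ∑ N ∈ (Finset.univ : Finset (Finset (Fin (k + 1) ⊕ (Fin n ⊕ Fin n)))).filter
        (fun N => N.card = Fintype.card (Option (Fin n))), wch α (av f σ) ∅ Finset.univ N ≠ 0 := by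
  by_contra! hcon
  have h1 : ∑ σ : Equiv.Perm (Fin (k + 1)), ∑ i : Fin (k + 1), α.toFun (dc (Set.range
      (fun m : Fin k => yv f (σ (m.succ + (i + 1))) - yv f (σ (m.castSucc + (i + 1)))))) = 0 :=
    Finset.sum_eq_zero fun σ _ => by rw [← sum_trv α hf (av_block hk hf hsp σ), hcon σ]
  rw [Finset.sum_comm] at h1
  have h2 : ∀ i : Fin (k + 1), ∑ σ : Equiv.Perm (Fin (k + 1)), α.toFun (dc (Set.range
      (fun m : Fin k => yv f (σ (m.succ + (i + 1))) - yv f (σ (m.castSucc + (i + 1)))))) = 1 := by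
    intro i
    have h3 := perm_lemma α k (yv f) (yv_inj hf) ∅ Set.finite_empty
    rw [dc_empty, α.norm', ← Equiv.sum_comp (Equiv.mulRight (Equiv.addRight (i + 1)))] at h3
    rw [← h3]
    refine Finset.sum_congr rfl fun σ _ => ?_
    rw [Set.empty_union]
    rfl
  rw [Finset.sum_congr rfl fun i _ => h2 i] at h1
  simp at h1
  exact absurd h1 (by positivity)

end family

section uniq

theorem neg_one_pow_sub_aux {i n : ℕ} (h : i ≤ n) :
    (-1 : ℝ) ^ (n - i) = (-1) ^ n * (-1) ^ i := by
  obtain ⟨m, rfl⟩ := Nat.exists_eq_add_of_le h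
  rw [Nat.add_sub_cancel_left, pow_add, mul_right_comm, ← mul_pow]
  simp

theorem exists_frame {n : ℕ} (hn : n < d) : ∃ f : Fin (d - n) ⊕ Fin n → Euc d,
    LinearIndependent ℝ f ∧ ∀ x : Euc d, (∀ t, ⟪f t, x⟫_ℝ = 0) → x = 0 := by
  let e : Fin (d - n) ⊕ Fin n ≃ Fin d := finSumFinEquiv.trans (finCongr (by omega))
  let B := EuclideanSpace.basisFun (Fin d) ℝ
  refine ⟨fun t => B (e t), B.orthonormal.linearIndependent.comp e e.injective, ?_⟩
  intro x hx
  ext i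
  have := hx (e.symm i)
  simpa [B, EuclideanSpace.inner_single_left] using this

theorem hbin_zero (α : ConeAngle d) (c : ℕ → ℝ)
    (hc : ∀ P : Set (Euc d), IsPolytope P → sdim P = d →
      ∑ k ∈ Finset.range (d + 1), c k * intAngleSum α P k = 0) :
    ∀ t r : ℕ, r + t = d → 1 ≤ r → hbin d c r = 0 := by
  intro t
  induction t using Nat.strong_induction_on with
  | _ t IH =>
  intro r hr hr1
  obtain ⟨n, rfl⟩ := Nat.exists_eq_add_of_le' hr1
  obtain ⟨f, hf, hsp⟩ := exists_frame (d := d) (n := n) (by omega)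
  obtain ⟨σ, hσ⟩ := exists_good α (by omega) hf hsp
  have hB := av_block (by omega) hf hsp σ
  have h1 := hB.total α c (by
    intro m hm hmd
    rw [Fintype.card_option, Fintype.card_fin] at hm
    exact IH (d - m) (by omega) m (by omega) (by omega))
  rw [hc _ hB.polytope hB.sdim_eq] at h1
  have h2 := (mul_eq_zero.1 h1.symm).resolve_right hσ
  rwa [Fintype.card_option, Fintype.card_fin] at h2

theorem coeffs (α : ConeAngle d) (c : ℕ → ℝ)
    (hc : ∀ P : Set (Euc d), IsPolytope P → sdim P = d →
      ∑ k ∈ Finset.range (d + 1), c k * intAngleSum α P k = 0) :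
    ∀ m : ℕ, m ≤ d → c (d - m) = (-1) ^ m * c d := by
  intro m
  induction m using Nat.strong_induction_on with
  | _ m IH =>
  intro hm
  rcases Nat.eq_zero_or_pos m with rfl | hpos
  · simp
  have h1 := hbin_zero α c hc (d - m) m (by omega) hpos
  unfold hbin at h1
  have h2 : (∑ j ∈ Finset.range (m + 1), (-1 : ℝ) ^ j * (m.choose j : ℝ)) = 0 := by
    have := Int.alternating_sum_range_choose_of_ne hpos.ne'
    exact_mod_cast this
  rw [Finset.sum_range_succ] at h1 h2
  have h3 : ∑ j ∈ Finset.range m, (m.choose j : ℝ) * c (d - j) =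
      (∑ j ∈ Finset.range m, (-1 : ℝ) ^ j * (m.choose j : ℝ)) * c d := by
    rw [Finset.sum_mul]
    refine Finset.sum_congr rfl fun j hj => ?_
    have hj' := Finset.mem_range.1 hj
    rw [IH j hj' (by omega)]
    ring
  rw [h3, Nat.choose_self, Nat.cast_one, one_mul] at h1
  rw [Nat.choose_self, Nat.cast_one, mul_one] at h2
  have h4 : (∑ j ∈ Finset.range m, (-1 : ℝ) ^ j * (m.choose j : ℝ)) = - (-1) ^ m := by linarith
  rw [h4] at h1
  linarith

theorem angle_top' (α : ConeAngle d) {P : Set (Euc d)} (hP : IsPolytope P) (hd : sdim P = d) :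
    intAngleSum α P d = 1 := by
  have hne : P.Nonempty := by
    obtain ⟨s, ⟨v, hv⟩, rfl⟩ := hP
    exact ⟨v, subset_convexHull ℝ _ hv⟩
  obtain ⟨n, I, a, b, ha, rfl⟩ := polytope_HP hP
  exact angle_top α ha hne (vspan_top hd)

theorem exists_poly (hd : 0 < d) : ∃ P : Set (Euc d), IsPolytope P ∧ sdim P = d := by
  obtain ⟨f, hf, hsp⟩ := exists_frame (d := d) (n := 0) hd
  have hB := av_block (by omega) hf hsp 1
  exact ⟨_, hB.polytope, hB.sdim_eq⟩

end uniq

end aux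

/-- Theorem 1.1, Gram's relation and its uniqueness.
For `d ≥ 1` and any cone angle `α` on `ℝ^d`, the affine hull of the interior angle
vectors of `d`-dimensional polytopes `P ⊂ ℝ^d` is exactly the hyperplane
`{a : a₀ - a₁ + ⋯ + (-1)^{d-1} a_{d-1} = (-1)^{d+1}}`; in particular every
full-dimensional polytope satisfies Gram's relation, and up to scaling it is the only
linear relation satisfied by all interior angle vectors. -/
theorem statement0 (d : ℕ) (hd : 0 < d) (α : ConeAngle d) :
    (affineSpan ℝ {v : Fin d → ℝ | ∃ P : Set (Euc d), IsPolytope P ∧ sdim P = d ∧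
        v = fun i : Fin d => intAngleSum α P (i : ℕ)} : Set (Fin d → ℝ)) =
      {a : Fin d → ℝ | ∑ i : Fin d, (-1 : ℝ) ^ (i : ℕ) * a i = (-1) ^ (d + 1)} := by
  set S : Set (Fin d → ℝ) := {v : Fin d → ℝ | ∃ P : Set (Euc d), IsPolytope P ∧ sdim P = d ∧
        v = fun i : Fin d => intAngleSum α P (i : ℕ)} with hS
  ext v
  constructor
  · intro hv
    refine affineSpan_induction (p := fun v : Fin d → ℝ =>
      ∑ i : Fin d, (-1 : ℝ) ^ (i : ℕ) * v i = (-1) ^ (d + 1)) hv ?_ ?_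
    · rintro _ ⟨P, hP, hPd, rfl⟩
      rw [← gram_range α hP hPd, Finset.sum_range]
    · intro c u v w hu hv hw
      simp only [vsub_eq_sub, vadd_eq_add, Pi.add_apply, Pi.smul_apply, Pi.sub_apply, smul_eq_mul]
      have : ∀ i : Fin d, (-1 : ℝ) ^ (i : ℕ) * (c * (u i - v i) + w i) =
          c * ((-1 : ℝ) ^ (i : ℕ) * u i) - c * ((-1 : ℝ) ^ (i : ℕ) * v i) +
            (-1 : ℝ) ^ (i : ℕ) * w i := fun i => by ring
      simp only [this, Finset.sum_add_distrib, Finset.sum_sub_distrib, ← Finset.mul_sum, hu, hv, hw]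
      ring
  · intro hv
    have hv' : ∑ i : Fin d, (-1 : ℝ) ^ (i : ℕ) * v i = (-1) ^ (d + 1) := hv
    by_contra hcon
    obtain ⟨P0, hP0, hP0d⟩ := exists_poly hd
    set s0 : Fin d → ℝ := fun i : Fin d => intAngleSum α P0 (i : ℕ) with hs0
    have hs0S : s0 ∈ S := ⟨P0, hP0, hP0d, rfl⟩
    have hs0A : s0 ∈ affineSpan ℝ S := subset_affineSpan ℝ S hs0S
    have hnot : v - s0 ∉ (affineSpan ℝ S).direction := by
      intro h
      apply hcon
      have := AffineSubspace.vadd_mem_of_mem_direction h hs0A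
      simpa using this
    obtain ⟨φ, hφ, hker⟩ := Submodule.exists_le_ker_of_notMem hnot
    have hφs : ∀ w : Fin d → ℝ, φ w = ∑ i, φ (Pi.single i 1) * w i := by
      intro w
      conv_lhs => rw [← Finset.univ_sum_single w]
      rw [map_sum]
      refine Finset.sum_congr rfl fun i _ => ?_
      have : (Pi.single i (w i) : Fin d → ℝ) = w i • Pi.single i 1 := by
        rw [← Pi.single_smul, smul_eq_mul, mul_one]
      rw [this, map_smul, smul_eq_mul, mul_comm]
    have hconst : ∀ s ∈ S, φ s = φ s0 := by
      intro s hs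
      have h1 := hker (AffineSubspace.vsub_mem_direction (subset_affineSpan ℝ S hs) hs0A)
      rw [LinearMap.mem_ker, vsub_eq_sub, map_sub] at h1
      linarith
    let c : ℕ → ℝ := fun k => if h : k < d then φ (Pi.single ⟨k, h⟩ 1) else - φ s0
    have hcd : c d = - φ s0 := by simp [c]
    have hci : ∀ i : Fin d, c i = φ (Pi.single i 1) := fun i => by simp [c]
    have hco := coeffs α c (by
      intro P hP hPd
      rw [Finset.sum_range_succ, angle_top' α hP hPd, hcd, Finset.sum_range]
      have := hconst _ ⟨P, hP, hPd, rfl⟩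
      rw [hφs] at this
      simp only [hci]
      rw [this]
      ring)
    apply hφ
    rw [map_sub, sub_eq_zero, hφs]
    have h1 : ∀ i : Fin d, φ (Pi.single i 1) * v i =
        ((-1) ^ d * - φ s0) * ((-1 : ℝ) ^ (i : ℕ) * v i) := by
      intro i
      have h2 := hco (d - i) (by omega)
      rw [show d - (d - (i : ℕ)) = i by omega, hci, hcd] at h2
      have h3 : (-1 : ℝ) ^ (d - (i : ℕ)) = (-1) ^ d * (-1) ^ (i : ℕ) := by
        exact neg_one_pow_sub_aux i.2.le
      rw [h2, h3]
      ring
    rw [Finset.sum_congr rfl fun i _ => h1 i, ← Finset.mul_sum, hv', pow_succ]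
    have : ((-1 : ℝ) ^ d) * (-1) ^ d = 1 := by rw [← mul_pow]; simp
    linear_combination (φ s0) * this

end GramAngles
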